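/- arXiv:1406.5938 — 8 statements merged into one kernel-verified Lean document; each statement's English description precedes it below -/
import Mathlib

section
/- Let n ≥ 3 be an integer, p = (n+2)/(n−2), γ = n(n−2)/4, and let Q : ℝⁿ → ℝ be a smooth (C^∞) function satisfying ΔQ(x) + γ|Q(x)|^(p−1)Q(x) = 0 for all x ∈ ℝⁿ. Then for any index 1 ≤ j ≤ n, the function φ(x) = (2−n)·x_j·Q(x) + |x|²·∂Q/∂x_j(x) − 2x_j·(x·∇Q(x)) satisfies Δφ(x) + pγ|Q(x)|^(p−1)φ(x) = 0 for all x ∈ ℝⁿ. -/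
open scoped BigOperators
open Real

/-- The Euclidean Laplacian, written as the sum of second partial derivatives. -/
noncomputable def lap {n : ℕ} (f : EuclideanSpace ℝ (Fin n) → ℝ)
    (x : EuclideanSpace ℝ (Fin n)) : ℝ :=
  ∑ i, fderiv ℝ (fun y => fderiv ℝ f y (EuclideanSpace.single i 1)) x (EuclideanSpace.single i 1)

open scoped ContDiff

/-- The partial derivative in the `i`-th coordinate direction. -/
noncomputable def partialDeriv {n : ℕ} (i : Fin n) (f : EuclideanSpace ℝ (Fin n) → ℝ)
    (x : EuclideanSpace ℝ (Fin n)) : ℝ :=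
  fderiv ℝ f x (EuclideanSpace.single i 1)

section PartialDeriv

variable {n : ℕ} {f g : EuclideanSpace ℝ (Fin n) → ℝ}

theorem lap_eq_sum_partialDeriv (f : EuclideanSpace ℝ (Fin n) → ℝ)
    (x : EuclideanSpace ℝ (Fin n)) : lap f x = ∑ i, partialDeriv i (partialDeriv i f) x := rfl

theorem ContDiff.partialDeriv (hf : ContDiff ℝ ∞ f) (i : Fin n) :
    ContDiff ℝ ∞ (partialDeriv i f) :=
  (hf.fderiv_right (m := ∞) (by simp)).clm_apply contDiff_const

theorem ContDiff.differentiable_of_infty (hf : ContDiff ℝ ∞ f) : Differentiable ℝ f :=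
  hf.differentiable (by simp)

theorem contDiff_coord (k : Fin n) :
    ContDiff ℝ ∞ (fun y : EuclideanSpace ℝ (Fin n) => y k) := by fun_prop

theorem contDiff_norm_sq_euclidean :
    ContDiff ℝ ∞ (fun y : EuclideanSpace ℝ (Fin n) => ‖y‖ ^ 2) := contDiff_norm_sq ℝ

theorem partialDeriv_add (hf : Differentiable ℝ f) (hg : Differentiable ℝ g) (i : Fin n) :
    partialDeriv i (fun y => f y + g y) = fun y => partialDeriv i f y + partialDeriv i g y := by
  ext y
  simp [partialDeriv, fderiv_fun_add (hf y) (hg y)]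

theorem partialDeriv_mul (hf : Differentiable ℝ f) (hg : Differentiable ℝ g) (i : Fin n) :
    partialDeriv i (fun y => f y * g y) =
      fun y => f y * partialDeriv i g y + partialDeriv i f y * g y := by
  ext y
  simp [partialDeriv, fderiv_fun_mul (hf y) (hg y), mul_comm]

theorem partialDeriv_const_mul (hf : Differentiable ℝ f) (c : ℝ) (i : Fin n) :
    partialDeriv i (fun y => c * f y) = fun y => c * partialDeriv i f y := by
  ext y
  simp [partialDeriv, fderiv_const_mul (hf y)]

theorem partialDeriv_sum {ι : Type*} (s : Finset ι) {F : ι → EuclideanSpace ℝ (Fin n) → ℝ}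
    (hF : ∀ k ∈ s, Differentiable ℝ (F k)) (i : Fin n) :
    partialDeriv i (fun y => ∑ k ∈ s, F k y) = fun y => ∑ k ∈ s, partialDeriv i (F k) y := by
  ext y
  simp [partialDeriv, fderiv_fun_sum fun k hk => hF k hk y]

theorem partialDeriv_coord (i k : Fin n) :
    partialDeriv i (fun y => y k) = fun _ => if i = k then 1 else 0 := by
  ext y
  have h : HasFDerivAt (fun y : EuclideanSpace ℝ (Fin n) => y k)
      (EuclideanSpace.proj k : EuclideanSpace ℝ (Fin n) →L[ℝ] ℝ) y :=
    (EuclideanSpace.proj k : EuclideanSpace ℝ (Fin n) →L[ℝ] ℝ).hasFDerivAt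
  simp [partialDeriv, h.fderiv, eq_comm]

theorem partialDeriv_const (c : ℝ) (i : Fin n) :
    partialDeriv i (fun _ => c) = fun _ => 0 := by
  ext y
  simp [partialDeriv]

theorem partialDeriv_norm_sq (i : Fin n) :
    partialDeriv i (fun y => ‖y‖ ^ 2) = fun y => 2 * y i := by
  ext y
  simp [partialDeriv, fderiv_norm_sq_apply, EuclideanSpace.inner_single_right]

theorem partialDeriv_comm (hf : ContDiff ℝ ∞ f) (i k : Fin n) :
    partialDeriv i (partialDeriv k f) = partialDeriv k (partialDeriv i f) := by
  ext y
  have hd : DifferentiableAt ℝ (fderiv ℝ f) y :=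
    (hf.fderiv_right (m := ∞) (by simp)).differentiable (by simp) y
  have key (a b : Fin n) : partialDeriv a (partialDeriv b f) y =
      fderiv ℝ (fderiv ℝ f) y (EuclideanSpace.single a 1) (EuclideanSpace.single b 1) := by
    unfold partialDeriv
    rw [fderiv_clm_apply hd (differentiableAt_const _)]
    simp
  rw [key, key]
  exact ((contDiff_infty.mp hf 2).contDiffAt.isSymmSndFDerivAt (by simp)).eq _ _

theorem lap_add (hf : ContDiff ℝ ∞ f) (hg : ContDiff ℝ ∞ g) (x : EuclideanSpace ℝ (Fin n)) :
    lap (fun y => f y + g y) x = lap f x + lap g x := by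
  simp only [lap_eq_sum_partialDeriv, ← Finset.sum_add_distrib]
  refine Finset.sum_congr rfl fun i _ => ?_
  rw [partialDeriv_add hf.differentiable_of_infty hg.differentiable_of_infty,
    partialDeriv_add (hf.partialDeriv i).differentiable_of_infty
      (hg.partialDeriv i).differentiable_of_infty]

theorem lap_const_mul (hf : ContDiff ℝ ∞ f) (c : ℝ) (x : EuclideanSpace ℝ (Fin n)) :
    lap (fun y => c * f y) x = c * lap f x := by
  simp only [lap_eq_sum_partialDeriv, Finset.mul_sum]
  refine Finset.sum_congr rfl fun i _ => ?_
  rw [partialDeriv_const_mul hf.differentiable_of_infty,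
    partialDeriv_const_mul (hf.partialDeriv i).differentiable_of_infty]

theorem lap_sum {ι : Type*} (s : Finset ι) {F : ι → EuclideanSpace ℝ (Fin n) → ℝ}
    (hF : ∀ k ∈ s, ContDiff ℝ ∞ (F k)) (x : EuclideanSpace ℝ (Fin n)) :
    lap (fun y => ∑ k ∈ s, F k y) x = ∑ k ∈ s, lap (F k) x := by
  simp only [lap_eq_sum_partialDeriv]
  rw [Finset.sum_comm]
  refine Finset.sum_congr rfl fun i _ => ?_
  rw [partialDeriv_sum s fun k hk => (hF k hk).differentiable_of_infty,
    partialDeriv_sum s fun k hk => ((hF k hk).partialDeriv i).differentiable_of_infty]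

theorem lap_mul (hf : ContDiff ℝ ∞ f) (hg : ContDiff ℝ ∞ g) (x : EuclideanSpace ℝ (Fin n)) :
    lap (fun y => f y * g y) x =
      f x * lap g x + 2 * ∑ i, partialDeriv i f x * partialDeriv i g x + lap f x * g x := by
  simp only [lap_eq_sum_partialDeriv, Finset.mul_sum, Finset.sum_mul, ← Finset.sum_add_distrib]
  refine Finset.sum_congr rfl fun i _ => ?_
  have hf' := hf.differentiable_of_infty
  have hg' := hg.differentiable_of_infty
  have hfi := hf.partialDeriv i
  have hgi := hg.partialDeriv i
  rw [partialDeriv_mul hf' hg',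
    partialDeriv_add (hf.mul hgi).differentiable_of_infty (hfi.mul hg).differentiable_of_infty,
    partialDeriv_mul hf' hgi.differentiable_of_infty,
    partialDeriv_mul hfi.differentiable_of_infty hg']
  ring

theorem lap_coord_mul (hf : ContDiff ℝ ∞ f) (k : Fin n) (x : EuclideanSpace ℝ (Fin n)) :
    lap (fun y => y k * f y) x = x k * lap f x + 2 * partialDeriv k f x := by
  rw [lap_mul (contDiff_coord k) hf]
  simp [lap_eq_sum_partialDeriv (fun y => y k), partialDeriv_coord, partialDeriv_const]

theorem lap_norm_sq_mul (hf : ContDiff ℝ ∞ f) (x : EuclideanSpace ℝ (Fin n)) :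
    lap (fun y => ‖y‖ ^ 2 * f y) x =
      ‖x‖ ^ 2 * lap f x + 4 * ∑ i, x i * partialDeriv i f x + 2 * n * f x := by
  have h (i : Fin n) := partialDeriv_const_mul (contDiff_coord i).differentiable_of_infty 2 i
  rw [lap_mul contDiff_norm_sq_euclidean hf]
  simp only [lap_eq_sum_partialDeriv (fun y => ‖y‖ ^ 2), partialDeriv_norm_sq, h,
    partialDeriv_coord, mul_assoc, ← Finset.mul_sum]
  simp
  ring

theorem partialDeriv_lap (hf : ContDiff ℝ ∞ f) (k : Fin n) (x : EuclideanSpace ℝ (Fin n)) :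
    partialDeriv k (lap f) x = lap (partialDeriv k f) x := by
  have h := partialDeriv_sum Finset.univ
    (fun i _ => ((hf.partialDeriv i).partialDeriv i).differentiable_of_infty) k
  rw [lap_eq_sum_partialDeriv]
  refine (congrFun h x).trans (Finset.sum_congr rfl fun i _ => ?_)
  rw [partialDeriv_comm (hf.partialDeriv i) k i, partialDeriv_comm hf k i]

theorem partialDeriv_euler (hf : ContDiff ℝ ∞ f) (k : Fin n) (x : EuclideanSpace ℝ (Fin n)) :
    partialDeriv k (fun y => ∑ i, y i * partialDeriv i f y) x =
      partialDeriv k f x + ∑ i, x i * partialDeriv i (partialDeriv k f) x := by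
  rw [partialDeriv_sum Finset.univ
    fun i _ => ((contDiff_coord i).mul (hf.partialDeriv i)).differentiable_of_infty]
  simp only [fun i => partialDeriv_mul (contDiff_coord i).differentiable_of_infty
    (hf.partialDeriv i).differentiable_of_infty k, partialDeriv_coord, partialDeriv_comm hf k,
    Finset.sum_add_distrib]
  simp [add_comm]

theorem lap_euler (hf : ContDiff ℝ ∞ f) (x : EuclideanSpace ℝ (Fin n)) :
    lap (fun y => ∑ i, y i * partialDeriv i f y) x =
      2 * lap f x + ∑ i, x i * lap (partialDeriv i f) x := by
  rw [lap_sum Finset.univ fun i _ => (contDiff_coord i).mul (hf.partialDeriv i)]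
  simp only [fun i => lap_coord_mul (hf.partialDeriv i) i, Finset.sum_add_distrib,
    ← Finset.mul_sum, ← lap_eq_sum_partialDeriv]
  ring

/-- The Laplacian commutes with the conformal vector field
`|x|² ∂ₖ - 2 xₖ (x·∇)` up to the weight `2 - n`. -/
theorem lap_kelvin (hf : ContDiff ℝ ∞ f) (k : Fin n) (x : EuclideanSpace ℝ (Fin n)) :
    lap (fun y => (2 - (n : ℝ)) * y k * f y + ‖y‖ ^ 2 * partialDeriv k f y -
        2 * y k * ∑ i, y i * partialDeriv i f y) x =
      -((n : ℝ) + 2) * x k * lap f x + ‖x‖ ^ 2 * lap (partialDeriv k f) x -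
        2 * x k * ∑ i, x i * lap (partialDeriv i f) x := by
  have hE : ContDiff ℝ ∞ (fun y => ∑ i, y i * partialDeriv i f y) :=
    ContDiff.sum fun i _ => (contDiff_coord i).mul (hf.partialDeriv i)
  have hk := hf.partialDeriv k
  have hrw : (fun y : EuclideanSpace ℝ (Fin n) =>
      (2 - (n : ℝ)) * y k * f y + ‖y‖ ^ 2 * partialDeriv k f y -
        2 * y k * ∑ i, y i * partialDeriv i f y) = fun y =>
      ((2 - (n : ℝ)) * (y k * f y) + ‖y‖ ^ 2 * partialDeriv k f y) +
        (-2) * (y k * ∑ i, y i * partialDeriv i f y) := by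
    ext y
    ring
  have h₁ := (contDiff_coord k).mul hf
  have h₂ := contDiff_norm_sq_euclidean.mul hk
  have h₃ := (contDiff_coord k).mul hE
  rw [hrw, lap_add ((contDiff_const.mul h₁).add h₂) (contDiff_const.mul h₃),
    lap_add (contDiff_const.mul h₁) h₂, lap_const_mul h₁, lap_const_mul h₃,
    lap_coord_mul hf, lap_norm_sq_mul hk, lap_coord_mul hE, lap_euler hf, partialDeriv_euler hf]
  ring

end PartialDeriv

theorem hasDerivAt_abs_rpow_mul_self {q : ℝ} (hq : 0 < q) (t : ℝ) :
    HasDerivAt (fun s : ℝ => |s| ^ q * s) ((q + 1) * |t| ^ q) t := by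
  rcases eq_or_ne t 0 with rfl | ht
  · rw [hasDerivAt_iff_tendsto_slope]
    have hc : Filter.Tendsto (fun s : ℝ => |s| ^ q) (nhds 0) (nhds (|0| ^ q)) :=
      (continuous_abs.rpow_const fun _ => Or.inr hq.le).tendsto 0
    have h0 : (q + 1) * |(0 : ℝ)| ^ q = |0| ^ q := by simp [Real.zero_rpow hq.ne']
    rw [h0]
    refine (hc.mono_left nhdsWithin_le_nhds).congr' ?_
    filter_upwards [self_mem_nhdsWithin] with s hs
    have hs' : s ≠ 0 := hs
    simp [slope_def_field, hs']
  · have h := (((hasDerivAt_abs ht).rpow_const (p := q) (Or.inl (abs_ne_zero.mpr ht))).mul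
      (hasDerivAt_id t))
    refine h.congr_deriv ?_
    have hsign : (SignType.sign t : ℝ) * t = |t| := sign_mul_self t
    have hpow : |t| ^ (q - 1) * |t| = |t| ^ q := by
      rw [← Real.rpow_add_one (abs_ne_zero.mpr ht), sub_add_cancel]
    simp only [id]
    linear_combination q * |t| ^ (q - 1) * hsign + q * hpow

/-- The Kelvin-translation generator `(2−n)x_j Q + |x|² ∂_j Q − 2x_j (x·∇Q)` lies in the
kernel of the linearized operator `Δ + pγ|Q|^(p-1)` at a solution `Q` of the critical
Yamabe equation. -/
theorem statement2 (n : ℕ) (hn : 3 ≤ n) (p γ : ℝ)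
    (hp : p = ((n : ℝ) + 2) / ((n : ℝ) - 2)) (hγ : γ = (n : ℝ) * ((n : ℝ) - 2) / 4)
    (Q : EuclideanSpace ℝ (Fin n) → ℝ) (hQ : ContDiff ℝ (⊤ : ℕ∞) Q)
    (heq : ∀ x, lap Q x + γ * |Q x| ^ (p - 1) * Q x = 0)
    (j : Fin n) :
    ∀ x, lap (fun y => (2 - (n : ℝ)) * y j * Q y +
        ‖y‖ ^ 2 * fderiv ℝ Q y (EuclideanSpace.single j 1) -
        2 * y j * ∑ i, y i * fderiv ℝ Q y (EuclideanSpace.single i 1)) x +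
      p * γ * |Q x| ^ (p - 1) *
        ((2 - (n : ℝ)) * x j * Q x +
          ‖x‖ ^ 2 * fderiv ℝ Q x (EuclideanSpace.single j 1) -
          2 * x j * ∑ i, x i * fderiv ℝ Q x (EuclideanSpace.single i 1)) = 0 := by
  intro x
  have hn' : (0 : ℝ) < (n : ℝ) - 2 := by
    have : (3 : ℝ) ≤ n := by exact_mod_cast hn
    linarith
  have hpn : p * ((n : ℝ) - 2) = n + 2 := by
    rw [hp]
    field_simp
  have hp1 : 0 < p - 1 := by
    have : p - 1 = 4 / ((n : ℝ) - 2) := by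
      rw [hp]
      field_simp
      ring
    rw [this]
    positivity
  have hlap : lap Q = fun y => -γ * (|Q y| ^ (p - 1) * Q y) := by
    ext y
    linear_combination heq y
  have hlin (k : Fin n) :
      lap (partialDeriv k Q) x = -γ * (p * |Q x| ^ (p - 1)) * partialDeriv k Q x := by
    have h := ((hasDerivAt_abs_rpow_mul_self hp1 (Q x)).comp_hasFDerivAt x
      (hQ.differentiable_of_infty x).hasFDerivAt).const_mul (-γ)
    rw [← partialDeriv_lap hQ, hlap]
    refine (congrArg (fun L => L (EuclideanSpace.single k 1)) h.fderiv).trans ?_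
    simp [partialDeriv, mul_assoc]
  have hsum : ∑ i, x i * lap (partialDeriv i Q) x =
      -γ * (p * |Q x| ^ (p - 1)) * ∑ i, x i * partialDeriv i Q x := by
    rw [Finset.mul_sum]
    refine Finset.sum_congr rfl fun i _ => ?_
    rw [hlin]
    ring
  have hkelvin := lap_kelvin hQ j x
  rw [hsum, hlin] at hkelvin
  simp only [partialDeriv] at hkelvin
  rw [hkelvin]
  linear_combination (-((n : ℝ) + 2) * x j) * heq x - γ * |Q x| ^ (p - 1) * x j * Q x * hpn
end

section
/- Let n ≥ 3 be an integer and let φ : ℝⁿ \ {0} → ℝ be a C² function. Define its Kelvin transform Kφ(y) = |y|^(2−n)·φ(y/|y|²) for y ≠ 0. Then for every y ∈ ℝⁿ \ {0}, Δ(Kφ)(y) = |y|^(−n−2)·(Δφ)(y/|y|²). -/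
open scoped BigOperators
open Real

section KelvinTransform

variable {E : Type*} [NormedAddCommGroup E] [InnerProductSpace ℝ E]

lemma hasFDerivAt_norm_rpow_of_ne_zero (a : ℝ) {z : E} (hz : z ≠ 0) :
    HasFDerivAt (fun x : E => ‖x‖ ^ a) ((a * ‖z‖ ^ (a - 2)) • innerSL ℝ z) z := by
  have hz' : 0 < ‖z‖ := norm_pos_iff.mpr hz
  have h := ((hasFDerivAt_id (𝕜 := ℝ) z).norm_sq).rpow_const (p := a / 2)
    (Or.inl (by simpa using hz))
  refine (h.congr_fderiv ?_).congr_of_eventuallyEq (Filter.Eventually.of_forall fun x => ?_)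
  · ext v
    have e : (‖z‖ ^ 2) ^ (a / 2 - 1) = ‖z‖ ^ (a - 2) := by
      rw [← Real.rpow_natCast, ← Real.rpow_mul hz'.le]
      congr 1
      push_cast
      ring
    simp [e]
    ring
  · change ‖x‖ ^ a = (‖x‖ ^ 2) ^ (a / 2)
    rw [← Real.rpow_natCast, ← Real.rpow_mul (norm_nonneg x)]
    congr 1
    push_cast
    ring

lemma hasFDerivAt_inv_norm_sq_smul {z : E} (hz : z ≠ 0) :
    HasFDerivAt (fun x : E => (‖x‖ ^ 2)⁻¹ • x)
      ((‖z‖ ^ 2)⁻¹ • ContinuousLinearMap.id ℝ E -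
        (2 * ((‖z‖ ^ 2)⁻¹) ^ 2) • (innerSL ℝ z).smulRight z) z := by
  have h := ((hasDerivAt_inv (x := ‖z‖ ^ 2) (by simpa using hz)).comp_hasFDerivAt z
    (hasFDerivAt_id (𝕜 := ℝ) z).norm_sq).smul (hasFDerivAt_id (𝕜 := ℝ) z)
  refine h.congr_fderiv ?_
  ext v
  simp [smul_smul, sub_eq_add_neg]
  module

lemma HasFDerivAt.comp_inv_norm_sq_smul {F : Type*} [NormedAddCommGroup F] [NormedSpace ℝ F]
    {g : E → F} {L : E →L[ℝ] F} {z : E} (hg : HasFDerivAt g L ((‖z‖ ^ 2)⁻¹ • z)) (hz : z ≠ 0) :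
    HasFDerivAt (fun x => g ((‖x‖ ^ 2)⁻¹ • x))
      (L.comp ((‖z‖ ^ 2)⁻¹ • ContinuousLinearMap.id ℝ E -
        (2 * ((‖z‖ ^ 2)⁻¹) ^ 2) • (innerSL ℝ z).smulRight z)) z :=
  HasFDerivAt.comp (f := fun x : E => (‖x‖ ^ 2)⁻¹ • x) z hg (hasFDerivAt_inv_norm_sq_smul hz)

lemma inv_norm_sq_smul_ne_zero {z : E} (hz : z ≠ 0) : (‖z‖ ^ 2)⁻¹ • z ≠ 0 := by
  simpa using hz

lemma fderiv_kelvin_apply (n : ℝ) {φ : E → ℝ} {z : E} (hz : z ≠ 0)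
    (hφ : DifferentiableAt ℝ φ ((‖z‖ ^ 2)⁻¹ • z)) (v : E) :
    fderiv ℝ (fun x => ‖x‖ ^ (2 - n) * φ ((‖x‖ ^ 2)⁻¹ • x)) z v =
      (2 - n) * (‖z‖ ^ (-n) * inner ℝ v z * φ ((‖z‖ ^ 2)⁻¹ • z)) +
        ‖z‖ ^ (-n) * fderiv ℝ φ ((‖z‖ ^ 2)⁻¹ • z) v -
        2 * (‖z‖ ^ (-n - 2) * inner ℝ v z * fderiv ℝ φ ((‖z‖ ^ 2)⁻¹ • z) z) := by
  have hz' : 0 < ‖z‖ := norm_pos_iff.mpr hz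
  have h := (hasFDerivAt_norm_rpow_of_ne_zero (2 - n) hz).mul
    (hφ.hasFDerivAt.comp_inv_norm_sq_smul hz)
  have h0 : ‖z‖ ^ (2 - n) = ‖z‖ ^ (-n) * ‖z‖ ^ 2 := by
    rw [← Real.rpow_natCast, ← Real.rpow_add hz']
    congr 1
    push_cast
    ring
  have h2 : ‖z‖ ^ (-n - 2) = ‖z‖ ^ (-n) * (‖z‖ ^ 2)⁻¹ := by
    rw [Real.rpow_sub hz', div_eq_mul_inv]
    norm_num
  have h1 : ‖z‖ ^ (2 - n - 2) = ‖z‖ ^ (-n) := by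
    congr 1
    ring
  have h' : fderiv ℝ (fun x => ‖x‖ ^ (2 - n) * φ ((‖x‖ ^ 2)⁻¹ • x)) z = _ := h.fderiv
  rw [h']
  simp only [add_apply, smul_apply,
    ContinuousLinearMap.comp_apply, sub_apply,
    ContinuousLinearMap.smulRight_apply, ContinuousLinearMap.id_apply, innerSL_apply_apply,
    map_sub, map_smul, smul_eq_mul, h0, h1, h2, real_inner_comm z v]
  field_simp
  ring

lemma fderiv_fderiv_kelvin_apply (n : ℝ) {φ : E → ℝ} (hφ : ContDiffOn ℝ 2 φ {0}ᶜ) {z : E}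
    (hz : z ≠ 0) (v : E) :
    fderiv ℝ (fun y => fderiv ℝ (fun x => ‖x‖ ^ (2 - n) * φ ((‖x‖ ^ 2)⁻¹ • x)) y v) z v =
      ‖z‖ ^ (-n - 2) * (
        (2 - n) * (-n * (inner ℝ v z) ^ 2 + ‖z‖ ^ 2 * ‖v‖ ^ 2) * φ ((‖z‖ ^ 2)⁻¹ • z) +
        (-2 * n) * (inner ℝ v z * fderiv ℝ φ ((‖z‖ ^ 2)⁻¹ • z) v) +
        (4 * n * (‖z‖ ^ 2)⁻¹ * (inner ℝ v z) ^ 2 - 2 * ‖v‖ ^ 2) *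
          fderiv ℝ φ ((‖z‖ ^ 2)⁻¹ • z) z +
        fderiv ℝ (fderiv ℝ φ) ((‖z‖ ^ 2)⁻¹ • z) v v -
        2 * (‖z‖ ^ 2)⁻¹ *
          (inner ℝ v z * fderiv ℝ (fderiv ℝ φ) ((‖z‖ ^ 2)⁻¹ • z) z v) -
        2 * (‖z‖ ^ 2)⁻¹ *
          (inner ℝ v z * fderiv ℝ (fderiv ℝ φ) ((‖z‖ ^ 2)⁻¹ • z) v z) +
        4 * ((‖z‖ ^ 2)⁻¹) ^ 2 * (inner ℝ v z) ^ 2 *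
          fderiv ℝ (fderiv ℝ φ) ((‖z‖ ^ 2)⁻¹ • z) z z) := by
  have hz' : 0 < ‖z‖ := norm_pos_iff.mpr hz
  have hC : ∀ x : E, x ≠ 0 → ContDiffAt ℝ 2 φ x := fun x hx =>
    hφ.contDiffAt (isOpen_compl_singleton.mem_nhds hx)
  have hev : (fun y => fderiv ℝ (fun x => ‖x‖ ^ (2 - n) * φ ((‖x‖ ^ 2)⁻¹ • x)) y v) =ᶠ[nhds z]
      fun y => (2 - n) * (‖y‖ ^ (-n) * inner ℝ v y * φ ((‖y‖ ^ 2)⁻¹ • y)) +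
        ‖y‖ ^ (-n) * fderiv ℝ φ ((‖y‖ ^ 2)⁻¹ • y) v -
        2 * (‖y‖ ^ (-n - 2) * inner ℝ v y * fderiv ℝ φ ((‖y‖ ^ 2)⁻¹ • y) y) := by
    filter_upwards [isOpen_compl_singleton.mem_nhds hz] with y hy
    exact fderiv_kelvin_apply n hy
      ((hC _ (inv_norm_sq_smul_ne_zero hy)).differentiableAt two_ne_zero) v
  have hCz := hC _ (inv_norm_sq_smul_ne_zero hz)
  have hφ1 := (hCz.differentiableAt two_ne_zero).hasFDerivAt.comp_inv_norm_sq_smul hz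
  have hφ2 := ((hCz.fderiv_right (m := 1) (by norm_num)).differentiableAt
    one_ne_zero).hasFDerivAt.comp_inv_norm_sq_smul hz
  have ht : HasFDerivAt (fun x : E => inner ℝ v x) (innerSL ℝ v) z := (innerSL ℝ v).hasFDerivAt
  have hp := hasFDerivAt_norm_rpow_of_ne_zero (-n) hz
  have hp2 := hasFDerivAt_norm_rpow_of_ne_zero (-n - 2) hz
  have h := ((((hp.mul ht).mul hφ1).const_mul (2 - n)).add
    (hp.mul (hφ2.clm_apply (hasFDerivAt_const v z)))).sub
    (((hp2.mul ht).mul (hφ2.clm_apply (hasFDerivAt_id z))).const_mul 2)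
  have h0 : ‖z‖ ^ (-n) = ‖z‖ ^ (-n - 2) * ‖z‖ ^ 2 := by
    rw [← Real.rpow_natCast, ← Real.rpow_add hz']
    congr 1
    push_cast
    ring
  have h4 : ‖z‖ ^ (-n - 2 - 2) = ‖z‖ ^ (-n - 2) * (‖z‖ ^ 2)⁻¹ := by
    rw [Real.rpow_sub hz', div_eq_mul_inv]
    norm_num
  rw [hev.fderiv_eq]
  refine (congrArg (fun L : E →L[ℝ] ℝ => L v) h.fderiv).trans ?_
  simp only [add_apply, smul_apply,
    ContinuousLinearMap.comp_apply, sub_apply,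
    ContinuousLinearMap.smulRight_apply, ContinuousLinearMap.id_apply, innerSL_apply_apply,
    ContinuousLinearMap.flip_apply, zero_apply, map_zero, zero_add, id_eq, Pi.mul_apply,
    map_sub, map_smul, smul_eq_mul, h0, h4, real_inner_comm z v,
    real_inner_self_eq_norm_sq]
  field_simp
  ring

end KelvinTransform

lemma EuclideanSpace.sum_coord_mul_map_single {n : ℕ} (L : EuclideanSpace ℝ (Fin n) →L[ℝ] ℝ)
    (z : EuclideanSpace ℝ (Fin n)) :
    ∑ i, z i * L (EuclideanSpace.single i 1) = L z := by
  conv_rhs => rw [← (EuclideanSpace.basisFun (Fin n) ℝ).sum_repr z]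
  simp

lemma lap_eq_sum_fderiv_fderiv {n : ℕ} {f : EuclideanSpace ℝ (Fin n) → ℝ}
    {x : EuclideanSpace ℝ (Fin n)} (hf : DifferentiableAt ℝ (fderiv ℝ f) x) :
    lap f x = ∑ i, fderiv ℝ (fderiv ℝ f) x (EuclideanSpace.single i 1)
      (EuclideanSpace.single i 1) := by
  refine Finset.sum_congr rfl fun i _ => ?_
  rw [fderiv_clm_apply hf (differentiableAt_const _)]
  simp

/-- For a C² function `φ` on `ℝⁿ \ {0}`, the Laplacian of its Kelvin transform
`Kφ(y) = |y|^(2−n) φ(y/|y|²)` satisfies `Δ(Kφ)(y) = |y|^(−n−2) (Δφ)(y/|y|²)`. -/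
theorem statement3 (n : ℕ) (hn : 3 ≤ n)
    (φ : EuclideanSpace ℝ (Fin n) → ℝ)
    (hφ : ContDiffOn ℝ 2 φ ({0}ᶜ : Set (EuclideanSpace ℝ (Fin n)))) :
    ∀ y : EuclideanSpace ℝ (Fin n), y ≠ 0 →
      lap (fun z => ‖z‖ ^ ((2 : ℝ) - (n : ℝ)) * φ ((‖z‖ ^ 2)⁻¹ • z)) y =
        ‖y‖ ^ (-(n : ℝ) - 2) * lap φ ((‖y‖ ^ 2)⁻¹ • y) := by
  intro y hy
  have hy' : 0 < ‖y‖ := norm_pos_iff.mpr hy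
  have hC : ContDiffAt ℝ 2 φ ((‖y‖ ^ 2)⁻¹ • y) :=
    hφ.contDiffAt (isOpen_compl_singleton.mem_nhds (inv_norm_sq_smul_ne_zero hy))
  rw [lap_eq_sum_fderiv_fderiv
    ((hC.fderiv_right (m := 1) (by norm_num)).differentiableAt one_ne_zero)]
  unfold lap
  simp only [fderiv_fderiv_kelvin_apply (n : ℝ) hφ hy]
  rw [← Finset.mul_sum]
  have hsq : ∑ i, y i ^ 2 = ‖y‖ ^ 2 := (EuclideanSpace.real_norm_sq_eq y).symm
  have h1 := EuclideanSpace.sum_coord_mul_map_single (fderiv ℝ φ ((‖y‖ ^ 2)⁻¹ • y)) y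
  have h2 := EuclideanSpace.sum_coord_mul_map_single
    (fderiv ℝ (fderiv ℝ φ) ((‖y‖ ^ 2)⁻¹ • y) y) y
  have h3 := EuclideanSpace.sum_coord_mul_map_single
    ((fderiv ℝ (fderiv ℝ φ) ((‖y‖ ^ 2)⁻¹ • y)).flip y) y
  simp only [ContinuousLinearMap.flip_apply] at h3
  simp only [EuclideanSpace.inner_single_left, PiLp.norm_single, map_one, one_mul,
    norm_one, one_pow, mul_one, Finset.sum_add_distrib, Finset.sum_sub_distrib,
    ← Finset.mul_sum, ← Finset.sum_mul, hsq, h1, h2, h3, Finset.sum_const, Finset.card_univ,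
    Fintype.card_fin, nsmul_eq_mul]
  field_simp
  ring
end

section
/- For every real number x with 0 ≤ x ≤ 2π, the series ∑_{j=1}^∞ (1 − cos(jx))/j⁴ converges and equals x²(2π−x)²/48. -/
open Real

/-- The fourth Bernoulli polynomial is `y⁴ - 2y³ + y² - 1/30`. -/
lemma eval_map_bernoulli_four (y : ℝ) :
    (Polynomial.map (algebraMap ℚ ℝ) (Polynomial.bernoulli 4)).eval y =
      y ^ 4 - 2 * y ^ 3 + y ^ 2 - 1 / 30 := by
  have h2 : bernoulli 2 = 1 / 6 := by
    rw [bernoulli_eq_bernoulli'_of_ne_one (by decide), bernoulli'_two]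
  have h3 : bernoulli 3 = 0 := by
    rw [bernoulli_eq_bernoulli'_of_ne_one (by decide), bernoulli'_three]
  have h4 : bernoulli 4 = -1 / 30 := by
    rw [bernoulli_eq_bernoulli'_of_ne_one (by decide), bernoulli'_four]
  have c2 : Nat.choose 4 2 = 6 := rfl
  simp [Polynomial.bernoulli, Finset.sum_range_succ, h2, h3, h4, c2, bernoulli_one]
  ring

/-- For `0 ≤ x ≤ 2π`, the series `∑_{j≥1} (1 − cos(jx))/j⁴` converges to
`x²(2π−x)²/48` (the Fourier series of the Bernoulli polynomial `B₄`). -/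
theorem statement5 (x : ℝ) (hx0 : 0 ≤ x) (hx : x ≤ 2 * π) :
    HasSum (fun j : ℕ => (1 - Real.cos (((j : ℝ) + 1) * x)) / ((j : ℝ) + 1) ^ 4)
      (x ^ 2 * (2 * π - x) ^ 2 / 48) := by
  have hy : x / (2 * π) ∈ Set.Icc (0 : ℝ) 1 :=
    ⟨by positivity, (div_le_one (by positivity)).2 hx⟩
  have h := hasSum_zeta_four.sub (hasSum_one_div_nat_pow_mul_cos two_ne_zero hy)
  rw [← hasSum_nat_add_iff' 1] at h
  convert! h using 1
  · ext j
    have : 2 * π * ((j : ℝ) + 1) * (x / (2 * π)) = ((j : ℝ) + 1) * x := by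
      field_simp
    push_cast
    rw [this]
    ring
  · rw [show 2 * 2 = 4 from rfl, eval_map_bernoulli_four]
    norm_num [Nat.factorial]
    field_simp
    ring
end

section
/- For every real number x with 0 < x < π, the number g(x) = ∑_{j=1}^∞ (1−cos(jx))/j⁴ is strictly positive and ∑_{j=1}^∞ cos(jx)/j² < (2/3)·(∑_{j=1}^∞ sin(jx)/j³)²/g(x). In other words, the condition g''(x) < ((n−2)/(n−1))·(g'(x))²/g(x) holds for all x ∈ (0,π) in dimension n = 4. -/
open Real

lemma eval_bernoulli_two (y : ℝ) :
    ((Polynomial.bernoulli 2).map (algebraMap ℚ ℝ)).eval y = y ^ 2 - y + 1 / 6 := by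
  simp [Polynomial.bernoulli, Finset.sum_range_succ, bernoulli_eq_bernoulli'_of_ne_one,
    bernoulli_one, bernoulli'_two, Polynomial.eval_add, Polynomial.map_monomial]
  ring

lemma eval_bernoulli_three (y : ℝ) :
    ((Polynomial.bernoulli 3).map (algebraMap ℚ ℝ)).eval y
      = y ^ 3 - 3 / 2 * y ^ 2 + 1 / 2 * y := by
  simp [Polynomial.bernoulli, Finset.sum_range_succ, bernoulli_eq_bernoulli'_of_ne_one,
    bernoulli_one, bernoulli'_two, bernoulli'_three, Polynomial.eval_add, Polynomial.map_monomial,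
    Nat.choose]
  ring

lemma eval_bernoulli_four (y : ℝ) :
    ((Polynomial.bernoulli 4).map (algebraMap ℚ ℝ)).eval y
      = y ^ 4 - 2 * y ^ 3 + y ^ 2 - 1 / 30 := by
  simp [Polynomial.bernoulli, Finset.sum_range_succ, bernoulli_eq_bernoulli'_of_ne_one,
    bernoulli_one, bernoulli'_two, bernoulli'_three, bernoulli'_four, Polynomial.eval_add,
    Polynomial.map_monomial, Nat.choose]
  ring

lemma div_two_pi_mem_Icc {x : ℝ} (hx : x ∈ Set.Icc 0 (2 * π)) :
    x / (2 * π) ∈ Set.Icc (0 : ℝ) 1 :=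
  ⟨div_nonneg hx.1 two_pi_pos.le, (div_le_one two_pi_pos).2 hx.2⟩

lemma two_pi_mul_mul_div (a x : ℝ) : 2 * π * a * (x / (2 * π)) = a * x := by
  field_simp

lemma hasSum_cos_div_sq {x : ℝ} (hx : x ∈ Set.Icc 0 (2 * π)) :
    HasSum (fun j : ℕ => cos (((j : ℝ) + 1) * x) / ((j : ℝ) + 1) ^ 2)
      ((3 * (π - x) ^ 2 - π ^ 2) / 12) := by
  have h := (hasSum_nat_add_iff' 1).2
    (hasSum_one_div_nat_pow_mul_cos one_ne_zero (div_two_pi_mem_Icc hx))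
  rw [show 2 * 1 = 2 from rfl, eval_bernoulli_two] at h
  convert! h using 1
  · ext j
    rw [two_pi_mul_mul_div]
    push_cast
    ring
  · simp [Nat.factorial]
    field_simp
    ring

lemma hasSum_sin_div_cube {x : ℝ} (hx : x ∈ Set.Icc 0 (2 * π)) :
    HasSum (fun j : ℕ => sin (((j : ℝ) + 1) * x) / ((j : ℝ) + 1) ^ 3)
      (x * (π - x) * (2 * π - x) / 12) := by
  have h := (hasSum_nat_add_iff' 1).2
    (hasSum_one_div_nat_pow_mul_sin one_ne_zero (div_two_pi_mem_Icc hx))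
  rw [show 2 * 1 + 1 = 3 from rfl, eval_bernoulli_three] at h
  convert! h using 1
  · ext j
    rw [two_pi_mul_mul_div]
    push_cast
    ring
  · simp [Nat.factorial]
    field_simp
    ring

lemma hasSum_cos_div_pow_four {x : ℝ} (hx : x ∈ Set.Icc 0 (2 * π)) :
    HasSum (fun j : ℕ => cos (((j : ℝ) + 1) * x) / ((j : ℝ) + 1) ^ 4)
      (π ^ 4 / 90 - x ^ 2 * (2 * π - x) ^ 2 / 48) := by
  have h := (hasSum_nat_add_iff' 1).2
    (hasSum_one_div_nat_pow_mul_cos two_ne_zero (div_two_pi_mem_Icc hx))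
  rw [eval_bernoulli_four] at h
  convert! h using 1
  · ext j
    rw [two_pi_mul_mul_div]
    push_cast
    ring
  · simp [Nat.factorial]
    field_simp
    ring

lemma hasSum_one_sub_cos_div_pow_four {x : ℝ} (hx : x ∈ Set.Icc 0 (2 * π)) :
    HasSum (fun j : ℕ => (1 - cos (((j : ℝ) + 1) * x)) / ((j : ℝ) + 1) ^ 4)
      (x ^ 2 * (2 * π - x) ^ 2 / 48) := by
  have h := (hasSum_cos_div_pow_four ⟨le_rfl, two_pi_pos.le⟩).sub (hasSum_cos_div_pow_four hx)
  convert! h using 1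
  · ext j
    rw [mul_zero, cos_zero, sub_div]
  · ring

/-- The nondegeneracy condition `g''(x) < ((n−2)/(n−1)) g'(x)²/g(x)` on `(0,π)` holds in
dimension `n = 4`, where `g(x) = ∑_{j≥1} (1−cos(jx))/j⁴`, `g' (x) = ∑_{j≥1} sin(jx)/j³`
and `g''(x) = ∑_{j≥1} cos(jx)/j²`. -/
theorem statement6 (x : ℝ) (hx0 : 0 < x) (hx : x < π) :
    0 < (∑' j : ℕ, (1 - Real.cos (((j : ℝ) + 1) * x)) / ((j : ℝ) + 1) ^ 4) ∧
    (∑' j : ℕ, Real.cos (((j : ℝ) + 1) * x) / ((j : ℝ) + 1) ^ 2) <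
      (2 / 3) * (∑' j : ℕ, Real.sin (((j : ℝ) + 1) * x) / ((j : ℝ) + 1) ^ 3) ^ 2 /
        (∑' j : ℕ, (1 - Real.cos (((j : ℝ) + 1) * x)) / ((j : ℝ) + 1) ^ 4) := by
  have hx' : x ∈ Set.Icc 0 (2 * π) := ⟨hx0.le, by linarith⟩
  have hy : 0 < 2 * π - x := by linarith
  rw [(hasSum_cos_div_sq hx').tsum_eq, (hasSum_sin_div_cube hx').tsum_eq,
    (hasSum_one_sub_cos_div_pow_four hx').tsum_eq]
  refine ⟨by positivity, ?_⟩
  rw [show 2 / 3 * (x * (π - x) * (2 * π - x) / 12) ^ 2 / (x ^ 2 * (2 * π - x) ^ 2 / 48)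
    = 2 / 9 * (π - x) ^ 2 by field_simp; ring]
  nlinarith [mul_pos hx0 hy, sq_pos_of_pos pi_pos]
end

section
/- Let n ≥ 3 be an integer, p = (n+2)/(n−2), U(x) = (2/(1+|x|²))^((n−2)/2), Z₀(x) = ((n−2)/2)·U(x) + x·∇U(x) and Z₁(x) = ∂U/∂x₁(x). Then ∫_{ℝⁿ} U^(p−1)·Z₀² dx = ∫_{ℝⁿ} U^(p−1)·Z₁² dx = 2^(n−2)·n·(n−2)²·π^(n/2)·Γ(n/2)/Γ(n+2). -/
open scoped BigOperators
open Real

/-- The standard bubble `U(x) = (2/(1+|x|²))^((n−2)/2)`. -/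
noncomputable def Ubub (n : ℕ) (x : EuclideanSpace ℝ (Fin n)) : ℝ :=
  (2 / (1 + ‖x‖ ^ 2)) ^ (((n : ℝ) - 2) / 2)

/-- The dilation kernel element `Z₀(x) = ((n−2)/2)U(x) + x·∇U(x)`. -/
noncomputable def Zdil (n : ℕ) (x : EuclideanSpace ℝ (Fin n)) : ℝ :=
  (((n : ℝ) - 2) / 2) * Ubub n x +
    ∑ i, x i * fderiv ℝ (Ubub n) x (EuclideanSpace.single i 1)

/-- The translation kernel element `Z_i(x) = ∂U/∂x_i(x)`. -/
noncomputable def Ztrans (n : ℕ) (i : Fin n) (x : EuclideanSpace ℝ (Fin n)) : ℝ :=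
  fderiv ℝ (Ubub n) x (EuclideanSpace.single i 1)

open MeasureTheory Set

/-- The derivative of `r ↦ r² / (1 + r²)`. -/
lemma hasDerivAt_sq_div_one_add_sq (r : ℝ) :
    HasDerivAt (fun r : ℝ => r ^ 2 / (1 + r ^ 2)) (2 * r / (1 + r ^ 2) ^ 2) r := by
  have h : (1 + r ^ 2) ≠ 0 := by positivity
  have h2 : HasDerivAt (fun r : ℝ => r ^ 2) (2 * r) r := by simpa using hasDerivAt_pow 2 r
  convert! h2.div (h2.const_add 1) h using 1
  ring

lemma injOn_sq_div_one_add_sq : InjOn (fun r : ℝ => r ^ 2 / (1 + r ^ 2)) (Ioi 0) := by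
  intro a ha b hb hab
  have ha' : (1 + a ^ 2) ≠ 0 := by positivity
  have hb' : (1 + b ^ 2) ≠ 0 := by positivity
  simp only [div_eq_div_iff ha' hb'] at hab
  exact (pow_left_inj₀ (le_of_lt ha) (le_of_lt hb) two_ne_zero).1 (by linarith)

lemma image_sq_div_one_add_sq : (fun r : ℝ => r ^ 2 / (1 + r ^ 2)) '' Ioi 0 = Ioo 0 1 := by
  ext t
  constructor
  · rintro ⟨r, hr, rfl⟩
    have hr' : 0 < r := hr
    exact ⟨by positivity, (div_lt_one (by positivity)).2 (by linarith)⟩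
  · rintro ⟨h0, h1⟩
    have h1' : 0 < 1 - t := by linarith
    refine ⟨√(t / (1 - t)), Real.sqrt_pos.2 (by positivity), ?_⟩
    simp only
    rw [Real.sq_sqrt (by positivity)]
    field_simp
    ring

/-- The substitution `t = r² / (1 + r²)` mapping `(0, ∞)` onto `(0, 1)`. -/
lemma integral_Ioi_comp_sq_div_one_add_sq (g : ℝ → ℝ) :
    ∫ r in Ioi (0 : ℝ), 2 * r / (1 + r ^ 2) ^ 2 * g (r ^ 2 / (1 + r ^ 2)) =
      ∫ t in Ioo (0 : ℝ) 1, g t := by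
  rw [← image_sq_div_one_add_sq, integral_image_eq_integral_abs_deriv_smul measurableSet_Ioi
    (fun r _ => (hasDerivAt_sq_div_one_add_sq r).hasDerivWithinAt) injOn_sq_div_one_add_sq]
  refine setIntegral_congr_fun measurableSet_Ioi fun r hr => ?_
  have hr' : 0 < r := hr
  simp only [smul_eq_mul]
  rw [abs_of_pos (by positivity)]

/-- The integral of a function of `‖x‖² / (1 + ‖x‖²)` against the spherical measure, written in
stereographic coordinates. -/
lemma integral_comp_norm_sq_div_one_add (n : ℕ) (hn : 1 ≤ n) (g : ℝ → ℝ) :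
    ∫ x : EuclideanSpace ℝ (Fin n), ((1 + ‖x‖ ^ 2) ^ n)⁻¹ * g (‖x‖ ^ 2 / (1 + ‖x‖ ^ 2)) =
      π ^ ((n : ℝ) / 2) / Real.Gamma ((n : ℝ) / 2) *
        ∫ t in Ioo (0 : ℝ) 1, t ^ ((n : ℝ) / 2 - 1) * (1 - t) ^ ((n : ℝ) / 2 - 1) * g t := by
  have : Nonempty (Fin n) := ⟨⟨0, hn⟩⟩
  have hn0 : (0 : ℝ) < n := by exact_mod_cast hn
  rw [integral_fun_norm_addHaar volume
    (fun r : ℝ => ((1 + r ^ 2) ^ n)⁻¹ * g (r ^ 2 / (1 + r ^ 2))),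
    ← integral_Ioi_comp_sq_div_one_add_sq]
  have hvol : volume.real (Metric.ball (0 : EuclideanSpace ℝ (Fin n)) 1) =
      π ^ ((n : ℝ) / 2) / Real.Gamma ((n : ℝ) / 2 + 1) := by
    rw [Measure.real, EuclideanSpace.volume_ball]
    simp only [ENNReal.ofReal_one, one_pow, one_mul, Fintype.card_fin]
    rw [ENNReal.toReal_ofReal (by positivity), Real.sqrt_eq_rpow, ← Real.rpow_natCast,
      ← Real.rpow_mul pi_pos.le]
    congr 2
    ring
  have hint : ∫ r in Ioi (0 : ℝ), 2 * r / (1 + r ^ 2) ^ 2 *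
      ((r ^ 2 / (1 + r ^ 2)) ^ ((n : ℝ) / 2 - 1) * (1 - r ^ 2 / (1 + r ^ 2)) ^ ((n : ℝ) / 2 - 1) *
        g (r ^ 2 / (1 + r ^ 2))) =
      2 * ∫ r in Ioi (0 : ℝ), r ^ (n - 1) • (((1 + r ^ 2) ^ n)⁻¹ * g (r ^ 2 / (1 + r ^ 2))) := by
    rw [← integral_const_mul]
    refine setIntegral_congr_fun measurableSet_Ioi fun r hr => ?_
    have hr' : 0 < r := hr
    have hs : 0 < 1 + r ^ 2 := by positivity
    have h1 : 1 - r ^ 2 / (1 + r ^ 2) = (1 + r ^ 2)⁻¹ := by field_simp; ring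
    have h2 : (r ^ 2 / (1 + r ^ 2)) ^ ((n : ℝ) / 2 - 1) *
        ((1 + r ^ 2)⁻¹) ^ ((n : ℝ) / 2 - 1) =
        r ^ n / r ^ 2 * ((1 + r ^ 2) ^ 2 / (1 + r ^ 2) ^ n) := by
      rw [← Real.mul_rpow (by positivity) (by positivity),
        show r ^ 2 / (1 + r ^ 2) * (1 + r ^ 2)⁻¹ = (r / (1 + r ^ 2)) ^ (2 : ℝ) by
          rw [Real.rpow_two]; field_simp,
        ← Real.rpow_mul (by positivity), show 2 * ((n : ℝ) / 2 - 1) = n - (2 : ℕ) by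
          push_cast; ring,
        Real.rpow_sub (by positivity), Real.rpow_natCast, Real.rpow_natCast, div_pow, div_pow]
      field_simp
    simp only [h1, h2, smul_eq_mul]
    obtain ⟨m, rfl⟩ := Nat.exists_eq_add_of_le' hn
    simp only [Nat.add_sub_cancel]
    field_simp
    ring
  rw [hint, hvol, Real.Gamma_add_one (by positivity)]
  simp only [finrank_euclideanSpace, Fintype.card_fin, nsmul_eq_mul, smul_eq_mul]
  field_simp

/-- Euler's beta integral over the reals. -/
lemma integral_Ioo_rpow_mul_one_sub_rpow {a b : ℝ} (ha : 0 < a) (hb : 0 < b) :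
    ∫ t in Ioo (0 : ℝ) 1, t ^ (a - 1) * (1 - t) ^ (b - 1) =
      Real.Gamma a * Real.Gamma b / Real.Gamma (a + b) := by
  have h := ProbabilityTheory.beta_eq_betaIntegralReal a b ha hb
  rw [ProbabilityTheory.beta] at h
  rw [h, Complex.betaIntegral, intervalIntegral.integral_of_le (by norm_num),
      ← integral_Ioc_eq_integral_Ioo, ← RCLike.re_to_complex, ← integral_re]
  · refine setIntegral_congr_fun measurableSet_Ioc fun x ⟨hx1, hx₂⟩ ↦ ?_
    norm_cast
    rw [← Complex.ofReal_cpow, ← Complex.ofReal_cpow, RCLike.re_to_complex,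
      Complex.re_mul_ofReal, Complex.ofReal_re]
    all_goals linarith
  · convert! Complex.betaIntegral_convergent (u := a) (v := b) (by simpa) (by simpa)
    rw [intervalIntegrable_iff_integrableOn_Ioc_of_le (by simp), IntegrableOn]

/-- Each coordinate contributes equally to `∫ g(‖x‖) ‖x‖²`. -/
lemma card_mul_integral_norm_mul_coord_sq {n : ℕ} (i : Fin n) (g : ℝ → ℝ)
    (hg : Integrable fun x : EuclideanSpace ℝ (Fin n) => g ‖x‖ * x i ^ 2) :
    (n : ℝ) * ∫ x : EuclideanSpace ℝ (Fin n), g ‖x‖ * x i ^ 2 =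
      ∫ x : EuclideanSpace ℝ (Fin n), g ‖x‖ * ‖x‖ ^ 2 := by
  have hswap (j : Fin n) : (fun x : EuclideanSpace ℝ (Fin n) => g ‖x‖ * x j ^ 2) =
      (fun x => g ‖x‖ * x i ^ 2) ∘
        LinearIsometryEquiv.piLpCongrLeft 2 ℝ ℝ (Equiv.swap i j) := by
    ext x
    simp [LinearIsometryEquiv.piLpCongrLeft_apply, Equiv.piCongrLeft'_apply]
  have hpres (j : Fin n) :=
    (LinearIsometryEquiv.piLpCongrLeft 2 ℝ ℝ (Equiv.swap i j)).measurePreserving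
  have hemb (j : Fin n) : MeasurableEmbedding
      (LinearIsometryEquiv.piLpCongrLeft 2 ℝ ℝ (Equiv.swap i j)) :=
    (LinearIsometryEquiv.piLpCongrLeft 2 ℝ ℝ
      (Equiv.swap i j)).toHomeomorph.measurableEmbedding
  have hint (j : Fin n) : Integrable fun x : EuclideanSpace ℝ (Fin n) => g ‖x‖ * x j ^ 2 := by
    rw [hswap j]
    exact (hpres j).integrable_comp_of_integrable hg
  have heq (j : Fin n) : ∫ x : EuclideanSpace ℝ (Fin n), g ‖x‖ * x j ^ 2 =
      ∫ x : EuclideanSpace ℝ (Fin n), g ‖x‖ * x i ^ 2 := by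
    rw [hswap j]
    exact (hpres j).integral_comp (hemb j) (fun x => g ‖x‖ * x i ^ 2)
  simp_rw [EuclideanSpace.real_norm_sq_eq, Finset.mul_sum]
  rw [integral_finsetSum _ fun j _ => hint j, Finset.sum_congr rfl fun j _ => heq j]
  simp

/-- The gradient of the bubble. -/
lemma fderiv_Ubub_single (n : ℕ) (x : EuclideanSpace ℝ (Fin n)) (i : Fin n) :
    fderiv ℝ (Ubub n) x (EuclideanSpace.single i 1) =
      -(((n : ℝ) - 2) * x i / (1 + ‖x‖ ^ 2) * Ubub n x) := by
  have hs : 0 < 1 + ‖x‖ ^ 2 := by positivity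
  have h1 : HasFDerivAt (fun y : EuclideanSpace ℝ (Fin n) => 1 + ‖y‖ ^ 2)
      (2 • innerSL ℝ x) x := (hasStrictFDerivAt_norm_sq x).hasFDerivAt.const_add 1
  have h2 : HasDerivAt (fun s : ℝ => (2 / s) ^ (((n : ℝ) - 2) / 2))
      (-2 / (1 + ‖x‖ ^ 2) ^ 2 * (((n : ℝ) - 2) / 2) *
        (2 / (1 + ‖x‖ ^ 2)) ^ (((n : ℝ) - 2) / 2 - 1)) (1 + ‖x‖ ^ 2) := by
    refine HasDerivAt.rpow_const ?_ (Or.inl (by positivity))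
    convert! (hasDerivAt_const (1 + ‖x‖ ^ 2) (2 : ℝ)).div (hasDerivAt_id _) hs.ne' using 1
    simp
  have h3 : HasFDerivAt (Ubub n) _ x :=
    HasDerivAt.comp_hasFDerivAt (h₂ := fun s : ℝ => (2 / s) ^ (((n : ℝ) - 2) / 2)) x h2 h1
  rw [h3.fderiv, Real.rpow_sub_one (by positivity)]
  simp [EuclideanSpace.inner_single_right, Ubub]
  field_simp

lemma Zdil_eq (n : ℕ) (x : EuclideanSpace ℝ (Fin n)) :
    Zdil n x = ((n : ℝ) - 2) / 2 * ((1 - ‖x‖ ^ 2) / (1 + ‖x‖ ^ 2)) * Ubub n x := by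
  have hsum : ∑ i, x i * fderiv ℝ (Ubub n) x (EuclideanSpace.single i 1) =
      -(((n : ℝ) - 2) / (1 + ‖x‖ ^ 2) * Ubub n x) * ‖x‖ ^ 2 := by
    rw [EuclideanSpace.real_norm_sq_eq x, Finset.mul_sum, ← EuclideanSpace.real_norm_sq_eq x]
    refine Finset.sum_congr rfl fun i _ => ?_
    rw [fderiv_Ubub_single]
    ring
  rw [Zdil, hsum]
  field_simp
  ring

lemma Ubub_sq {n : ℕ} (hn : 2 ≤ n) (x : EuclideanSpace ℝ (Fin n)) :
    Ubub n x ^ 2 = 2 ^ (n - 2) * (1 + ‖x‖ ^ 2) ^ 2 * ((1 + ‖x‖ ^ 2) ^ n)⁻¹ := by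
  obtain ⟨m, rfl⟩ := Nat.exists_eq_add_of_le' hn
  rw [Ubub, ← Real.rpow_natCast, ← Real.rpow_mul (by positivity),
    show (((m + 2 : ℕ) : ℝ) - 2) / 2 * (2 : ℕ) = (m : ℕ) by push_cast; ring, Real.rpow_natCast,
    Nat.add_sub_cancel, div_pow, pow_add]
  field_simp

lemma Ubub_rpow_critical {n : ℕ} (hn : 3 ≤ n) (x : EuclideanSpace ℝ (Fin n)) :
    Ubub n x ^ (((n : ℝ) + 2) / ((n : ℝ) - 2) - 1) = 4 / (1 + ‖x‖ ^ 2) ^ 2 := by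
  have hn' : (n : ℝ) - 2 ≠ 0 := by
    have : (3 : ℝ) ≤ n := by exact_mod_cast hn
    linarith
  rw [Ubub, ← Real.rpow_mul (by positivity),
    show ((n : ℝ) - 2) / 2 * (((n : ℝ) + 2) / ((n : ℝ) - 2) - 1) = (2 : ℕ) by
      push_cast; field_simp; ring, Real.rpow_natCast, div_pow]
  norm_num

/-- The weight `t ^ (a - 1) (1 - t) ^ (a - 1)` against `4 t (1 - t)`. -/
lemma integral_weight_mul_four_mul {a : ℝ} (ha : 0 < a) :
    ∫ t in Ioo (0 : ℝ) 1, t ^ (a - 1) * (1 - t) ^ (a - 1) * (4 * (t * (1 - t))) =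
      4 * a ^ 2 * Real.Gamma a ^ 2 / Real.Gamma (2 * a + 2) := by
  have h := integral_Ioo_rpow_mul_one_sub_rpow (a := a + 1) (b := a + 1) (by positivity)
    (by positivity)
  rw [Real.Gamma_add_one ha.ne', show a + 1 + (a + 1) = 2 * a + 2 by ring] at h
  rw [show 4 * a ^ 2 * Real.Gamma a ^ 2 / Real.Gamma (2 * a + 2) =
    4 * (a * Real.Gamma a * (a * Real.Gamma a) / Real.Gamma (2 * a + 2)) by ring, ← h,
    ← integral_const_mul]
  refine setIntegral_congr_fun measurableSet_Ioo fun t ht => ?_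
  have h1 : 0 < 1 - t := by linarith [ht.2]
  simp only [add_sub_cancel_right, Real.rpow_sub_one ht.1.ne', Real.rpow_sub_one h1.ne']
  have := ht.1
  field_simp

/-- The weight `t ^ (a - 1) (1 - t) ^ (a - 1)` against `(1 - 2t)²`. -/
lemma integral_weight_mul_one_sub_two_mul_sq {a : ℝ} (ha : 1 ≤ a) :
    ∫ t in Ioo (0 : ℝ) 1, t ^ (a - 1) * (1 - t) ^ (a - 1) * (1 - 2 * t) ^ 2 =
      2 * a * Real.Gamma a ^ 2 / Real.Gamma (2 * a + 2) := by
  have ha0 : 0 < a := by linarith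
  have hcont : Continuous fun t : ℝ => t ^ (a - 1) * (1 - t) ^ (a - 1) :=
    (Real.continuous_rpow_const (by linarith)).mul
      ((Real.continuous_rpow_const (by linarith)).comp (continuous_const.sub continuous_id))
  have hint {f : ℝ → ℝ} (hf : Continuous f) : IntegrableOn f (Ioo 0 1) :=
    (hf.integrableOn_Icc (a := 0) (b := 1)).mono_set Ioo_subset_Icc_self
  have hsplit : ∫ t in Ioo (0 : ℝ) 1, t ^ (a - 1) * (1 - t) ^ (a - 1) * (1 - 2 * t) ^ 2 =
      (∫ t in Ioo (0 : ℝ) 1, t ^ (a - 1) * (1 - t) ^ (a - 1)) -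
        ∫ t in Ioo (0 : ℝ) 1, t ^ (a - 1) * (1 - t) ^ (a - 1) * (4 * (t * (1 - t))) := by
    have hcont' : Continuous fun t : ℝ =>
        t ^ (a - 1) * (1 - t) ^ (a - 1) * (4 * (t * (1 - t))) := hcont.mul (by fun_prop)
    rw [← integral_sub (hint hcont) (hint hcont')]
    congr 1
    ext t
    ring
  rw [hsplit, integral_weight_mul_four_mul ha0, integral_Ioo_rpow_mul_one_sub_rpow ha0 ha0,
    show 2 * a + 2 = 2 * a + 1 + 1 by ring, Real.Gamma_add_one (by positivity),
    Real.Gamma_add_one (by positivity), ← two_mul]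
  have := Real.Gamma_pos_of_pos (show 0 < 2 * a by positivity)
  field_simp
  ring

/-- The squared coordinates are integrable against the spherical weight of `Z₁`. -/
lemma integrable_inv_one_add_norm_sq_pow_mul_coord_sq {n : ℕ} (i : Fin n) :
    Integrable fun x : EuclideanSpace ℝ (Fin n) => ((1 + ‖x‖ ^ 2) ^ (n + 2))⁻¹ * x i ^ 2 := by
  have h := integrable_rpow_neg_one_add_norm_sq (E := EuclideanSpace ℝ (Fin n)) (μ := volume)
    (r := 2 * (n + 1 : ℕ)) (by rw [finrank_euclideanSpace, Fintype.card_fin]; push_cast; linarith)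
  refine h.mono' ?_ (Filter.Eventually.of_forall fun x => ?_)
  · refine Continuous.aestronglyMeasurable ?_
    refine Continuous.mul (Continuous.inv₀ (by fun_prop) fun x => by positivity) (by fun_prop)
  · have hs : 0 < 1 + ‖x‖ ^ 2 := by positivity
    have hx : x i ^ 2 ≤ 1 + ‖x‖ ^ 2 := by
      have := pow_le_pow_left₀ (norm_nonneg _) (PiLp.norm_apply_le x i) 2
      rw [Real.norm_eq_abs, sq_abs] at this
      linarith
    rw [Real.norm_of_nonneg (by positivity),
      show -(2 * ((n + 1 : ℕ) : ℝ)) / 2 = -((n + 1 : ℕ) : ℝ) by ring, Real.rpow_neg hs.le,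
      Real.rpow_natCast]
    calc ((1 + ‖x‖ ^ 2) ^ (n + 2))⁻¹ * x i ^ 2
        ≤ ((1 + ‖x‖ ^ 2) ^ (n + 2))⁻¹ * (1 + ‖x‖ ^ 2) := by gcongr
      _ = ((1 + ‖x‖ ^ 2) ^ (n + 1))⁻¹ := by rw [pow_succ _ (n + 1)]; field_simp

/-- `∫ U^(p−1) Z₀² = ∫ U^(p−1) Z₁² = 2^(n−2) n (n−2)² π^(n/2) Γ(n/2)/Γ(n+2)`. -/
theorem statement12 (n : ℕ) (hn : 3 ≤ n) (p : ℝ)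
    (hp : p = ((n : ℝ) + 2) / ((n : ℝ) - 2)) :
    (∫ x : EuclideanSpace ℝ (Fin n), Ubub n x ^ (p - 1) * (Zdil n x) ^ 2) =
      2 ^ (n - 2) * (n : ℝ) * ((n : ℝ) - 2) ^ 2 * π ^ ((n : ℝ) / 2) *
        Real.Gamma ((n : ℝ) / 2) / Real.Gamma ((n : ℝ) + 2) ∧
    (∫ x : EuclideanSpace ℝ (Fin n),
        Ubub n x ^ (p - 1) * (Ztrans n ⟨0, by omega⟩ x) ^ 2) =
      2 ^ (n - 2) * (n : ℝ) * ((n : ℝ) - 2) ^ 2 * π ^ ((n : ℝ) / 2) *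
        Real.Gamma ((n : ℝ) / 2) / Real.Gamma ((n : ℝ) + 2) := by
  subst hp
  have hn3 : (3 : ℝ) ≤ n := by exact_mod_cast hn
  have hn0 : (0 : ℝ) < n := by linarith
  have h2a : 2 * ((n : ℝ) / 2) + 2 = n + 2 := by ring
  constructor
  · have hpt (x : EuclideanSpace ℝ (Fin n)) :
        Ubub n x ^ (((n : ℝ) + 2) / ((n : ℝ) - 2) - 1) * Zdil n x ^ 2 =
          2 ^ (n - 2) * ((n : ℝ) - 2) ^ 2 *
            (((1 + ‖x‖ ^ 2) ^ n)⁻¹ * (1 - 2 * (‖x‖ ^ 2 / (1 + ‖x‖ ^ 2))) ^ 2) := by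
      rw [Ubub_rpow_critical hn, Zdil_eq, mul_pow, Ubub_sq (by omega)]
      field_simp
      ring
    simp_rw [hpt]
    rw [integral_const_mul,
      integral_comp_norm_sq_div_one_add n (by omega) (fun t => (1 - 2 * t) ^ 2),
      integral_weight_mul_one_sub_two_mul_sq (by linarith), h2a]
    field_simp
  · have hpt (x : EuclideanSpace ℝ (Fin n)) :
        Ubub n x ^ (((n : ℝ) + 2) / ((n : ℝ) - 2) - 1) * Ztrans n ⟨0, by omega⟩ x ^ 2 =
          4 * 2 ^ (n - 2) * ((n : ℝ) - 2) ^ 2 *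
            (((1 + ‖x‖ ^ 2) ^ (n + 2))⁻¹ * x ⟨0, by omega⟩ ^ 2) := by
      rw [Ubub_rpow_critical hn, Ztrans, fderiv_Ubub_single, neg_sq, mul_pow,
        Ubub_sq (by omega), pow_add _ n]
      field_simp
    have hrad (x : EuclideanSpace ℝ (Fin n)) : ((1 + ‖x‖ ^ 2) ^ (n + 2))⁻¹ * ‖x‖ ^ 2 =
        4⁻¹ * (((1 + ‖x‖ ^ 2) ^ n)⁻¹ *
          (4 * (‖x‖ ^ 2 / (1 + ‖x‖ ^ 2) * (1 - ‖x‖ ^ 2 / (1 + ‖x‖ ^ 2))))) := by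
      rw [pow_add _ n]
      field_simp
      ring
    have hsym := card_mul_integral_norm_mul_coord_sq (⟨0, by omega⟩ : Fin n)
      (fun r => ((1 + r ^ 2) ^ (n + 2))⁻¹) (integrable_inv_one_add_norm_sq_pow_mul_coord_sq _)
    simp_rw [hrad] at hsym
    rw [integral_const_mul,
      integral_comp_norm_sq_div_one_add n (by omega) (fun t => 4 * (t * (1 - t))),
      integral_weight_mul_four_mul (by positivity), h2a, mul_comm, ← eq_div_iff hn0.ne'] at hsym
    simp_rw [hpt]
    rw [integral_const_mul, hsym]
    field_simp
    ring
end

section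
/- Let n ≥ 4 be an integer. There exist a constant C > 0 and an integer k₀ such that for every integer k ≥ k₀ and every integer m, | ∑_{j=1}^{k−1} cos(2πmj/k)/(1−cos(2πj/k))^((n−2)/2) − 2·(k/(√2·π))^(n−2) · ∑_{i=1}^∞ cos(2πmi/k)/i^(n−2) | ≤ C·k^(n−3). -/
open scoped BigOperators
open Real

theorem one_sub_cos_two_mul_rpow_half {y : ℝ} (hy : 0 < Real.sin y) (s : ℕ) :
    (1 - Real.cos (2 * y)) ^ ((s : ℝ) / 2) = (Real.sqrt 2 * Real.sin y) ^ s := by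
  have h : 1 - Real.cos (2 * y) = (Real.sqrt 2 * Real.sin y) ^ (2 : ℝ) := by
    rw [Real.rpow_two, mul_pow, Real.sq_sqrt zero_le_two, Real.cos_two_mul, Real.cos_sq']
    ring
  rw [h, ← Real.rpow_mul (by positivity), mul_div_cancel₀ _ two_ne_zero, Real.rpow_natCast]

theorem inv_sin_pow_sub_inv_pow_mem_Icc (t : ℕ) {x : ℝ} (hx : 0 < x) (hx' : x ≤ π / 2) :
    (Real.sin x)⁻¹ ^ (t + 2) - x⁻¹ ^ (t + 2) ∈
      Set.Icc 0 (((t : ℝ) + 2) / 2 * (π / 2) ^ (t + 2) * x⁻¹ ^ t) := by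
  have hsin : 0 < Real.sin x := Real.sin_pos_of_pos_of_lt_pi hx (by linarith [Real.pi_pos])
  have hle : Real.sin x ≤ x := (Real.sin_lt hx).le
  have hquad : 1 - x ^ 2 / 2 ≤ Real.sin x / x := by
    rcases hx'.eq_or_lt with h | h
    · have : 1 - x ^ 2 / 2 ≤ 0 := by
        have := Real.pi_gt_three
        nlinarith
      exact this.trans (by positivity)
    · have hcos : 0 < Real.cos x := Real.cos_pos_of_mem_Ioo ⟨by linarith, h⟩
      have htan := Real.lt_tan hx h
      rw [Real.tan_eq_sin_div_cos, lt_div_iff₀ hcos] at htan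
      rw [le_div_iff₀ hx]
      nlinarith [Real.one_sub_sq_div_two_le_cos (x := x)]
  have hinv : (Real.sin x)⁻¹ ≤ π / 2 * x⁻¹ := by
    have h := Real.mul_le_sin hx.le hx'
    rw [inv_le_comm₀ hsin (by positivity), mul_inv, inv_div, inv_inv]
    exact h
  constructor
  · rw [sub_nonneg]
    gcongr
  · have hratio : x⁻¹ ^ (t + 2) = (Real.sin x)⁻¹ ^ (t + 2) * (Real.sin x / x) ^ (t + 2) := by
      rw [← mul_pow]
      congr 1
      field_simp
    have hbern := one_add_mul_le_pow (a := Real.sin x / x - 1)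
      (by linarith [div_pos hsin hx]) (t + 2)
    rw [add_sub_cancel] at hbern
    push_cast at hbern
    have hlow : 1 - ((t : ℝ) + 2) / 2 * x ^ 2 ≤ (Real.sin x / x) ^ (t + 2) := by
      have : (0 : ℝ) ≤ (t : ℝ) + 2 := by positivity
      nlinarith
    calc (Real.sin x)⁻¹ ^ (t + 2) - x⁻¹ ^ (t + 2)
        = (Real.sin x)⁻¹ ^ (t + 2) * (1 - (Real.sin x / x) ^ (t + 2)) := by rw [hratio]; ring
      _ ≤ (Real.sin x)⁻¹ ^ (t + 2) * (((t : ℝ) + 2) / 2 * x ^ 2) := by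
          gcongr
          linarith
      _ ≤ (π / 2 * x⁻¹) ^ (t + 2) * (((t : ℝ) + 2) / 2 * x ^ 2) := by gcongr
      _ = ((t : ℝ) + 2) / 2 * (π / 2) ^ (t + 2) * x⁻¹ ^ t := by
          rw [mul_pow, pow_add x⁻¹]
          field_simp

theorem abs_inv_sin_pow_sub_le_of_le_half (t : ℕ) {x K : ℝ} (hx : 0 < x) (hx' : x ≤ π / 2)
    (hK : 1 ≤ K) (hxK : x⁻¹ ≤ K) :
    |(Real.sin x)⁻¹ ^ (t + 2) - x⁻¹ ^ (t + 2) - (π - x)⁻¹ ^ (t + 2)| ≤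
      (((t : ℝ) + 2) / 2 * (π / 2) ^ (t + 2) + 1) * K ^ t := by
  obtain ⟨h0, h1⟩ := inv_sin_pow_sub_inv_pow_mem_Icc t hx hx'
  have hpi : (1 : ℝ) ≤ π - x := by linarith [Real.pi_gt_three]
  have h2 : (π - x)⁻¹ ^ (t + 2) ≤ 1 :=
    pow_le_one₀ (inv_nonneg.2 (by linarith)) (inv_le_one_of_one_le₀ hpi)
  have h3 : 0 ≤ (π - x)⁻¹ ^ (t + 2) := pow_nonneg (inv_nonneg.2 (by linarith)) _
  have h4 : (1 : ℝ) ≤ K ^ t := one_le_pow₀ hK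
  have h5 : ((t : ℝ) + 2) / 2 * (π / 2) ^ (t + 2) * x⁻¹ ^ t ≤
      ((t : ℝ) + 2) / 2 * (π / 2) ^ (t + 2) * K ^ t := by gcongr
  have h6 : 0 ≤ ((t : ℝ) + 2) / 2 * (π / 2) ^ (t + 2) * K ^ t := by positivity
  rw [abs_le]
  constructor <;> linarith

theorem abs_inv_sin_pow_sub_le (t : ℕ) {x K : ℝ} (hx : 0 < x) (hx' : x < π)
    (hK : 1 ≤ K) (hxK : x⁻¹ ≤ K) (hxK' : (π - x)⁻¹ ≤ K) :
    |(Real.sin x)⁻¹ ^ (t + 2) - x⁻¹ ^ (t + 2) - (π - x)⁻¹ ^ (t + 2)| ≤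
      (((t : ℝ) + 2) / 2 * (π / 2) ^ (t + 2) + 1) * K ^ t := by
  rcases le_total x (π / 2) with h | h
  · exact abs_inv_sin_pow_sub_le_of_le_half t hx h hK hxK
  · have := abs_inv_sin_pow_sub_le_of_le_half t (x := π - x) (by linarith) (by linarith) hK hxK'
    rwa [Real.sin_pi_sub, sub_sub_cancel, sub_right_comm] at this

theorem sum_range_inv_add_sq_le {a : ℝ} (ha : 1 ≤ a) (N : ℕ) :
    ∑ i ∈ Finset.range N, ((i : ℝ) + a)⁻¹ ^ 2 ≤ 2 / a := by
  have h : ∑ i ∈ Finset.range N, ((i : ℝ) + a)⁻¹ ^ 2 ≤ 2 / a - 2 / ((N : ℝ) + a) := by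
    induction N with
    | zero => simp
    | succ N ih =>
      rw [Finset.sum_range_succ]
      have hN : 1 ≤ (N : ℝ) + a := by linarith [(Nat.cast_nonneg N : (0 : ℝ) ≤ N)]
      have : ((N : ℝ) + a)⁻¹ ^ 2 ≤ 2 / ((N : ℝ) + a) - 2 / (((N + 1 : ℕ) : ℝ) + a) := by
        push_cast
        rw [add_right_comm]
        generalize (N : ℝ) + a = b at hN
        rw [div_sub_div _ _ (by positivity) (by positivity), inv_pow, inv_eq_one_div,
          div_le_div_iff₀ (by positivity) (by positivity)]
        nlinarith
      linarith
  have : 0 ≤ 2 / ((N : ℝ) + a) := by positivity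
  linarith

theorem pow_mul_abs_tsum_sub_sum_le (t : ℕ) {k : ℕ} (hk : 1 ≤ k) {c : ℝ → ℝ}
    (hc : ∀ x, |c x| ≤ 1) :
    (k : ℝ) ^ (t + 2) * |(∑' i : ℕ, c ((i : ℝ) + 1) * ((i : ℝ) + 1)⁻¹ ^ (t + 2)) -
      ∑ i ∈ Finset.range (k - 1), c ((i : ℝ) + 1) * ((i : ℝ) + 1)⁻¹ ^ (t + 2)| ≤ 2 * k := by
  have hk' : (1 : ℝ) ≤ k := by exact_mod_cast hk
  have hsum : Summable fun i : ℕ => c ((i : ℝ) + 1) * ((i : ℝ) + 1)⁻¹ ^ (t + 2) := by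
    have h1 : Summable fun i : ℕ => ((i : ℝ) + 1)⁻¹ ^ (t + 2) := by
      have := (summable_nat_add_iff 1).2
        (Real.summable_nat_pow_inv.2 (show 1 < t + 2 by omega))
      simpa [inv_pow] using this
    refine Summable.of_norm_bounded h1 fun i => ?_
    rw [norm_mul, Real.norm_eq_abs, Real.norm_of_nonneg (by positivity)]
    exact mul_le_of_le_one_left (by positivity) (hc _)
  rw [← hsum.sum_add_tsum_nat_add (k - 1), add_sub_cancel_left]
  have hcast (i : ℕ) : (((i + (k - 1) : ℕ) : ℝ) + 1) = (i : ℝ) + k := by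
    have : i + (k - 1) + 1 = i + k := by omega
    exact_mod_cast this
  simp_rw [hcast]
  have hle (i : ℕ) : ‖c ((i : ℝ) + k) * ((i : ℝ) + k)⁻¹ ^ (t + 2)‖ ≤
      (k : ℝ)⁻¹ ^ t * ((i : ℝ) + k)⁻¹ ^ 2 := by
    rw [norm_mul, Real.norm_eq_abs, Real.norm_of_nonneg (by positivity)]
    refine (mul_le_of_le_one_left (by positivity) (hc _)).trans ?_
    rw [pow_add]
    gcongr
    exact le_add_of_nonneg_left (Nat.cast_nonneg i)
  have hsq : Summable fun i : ℕ => ((i : ℝ) + k)⁻¹ ^ 2 :=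
    summable_of_sum_range_le (fun i => by positivity) (sum_range_inv_add_sq_le hk')
  have hsq_le : ∑' i : ℕ, ((i : ℝ) + k)⁻¹ ^ 2 ≤ 2 / k :=
    Real.tsum_le_of_sum_range_le (fun i => by positivity) (sum_range_inv_add_sq_le hk')
  have htail := tsum_of_norm_bounded (hsq.mul_left ((k : ℝ)⁻¹ ^ t)).hasSum hle
  rw [tsum_mul_left, Real.norm_eq_abs] at htail
  calc _ ≤ (k : ℝ) ^ (t + 2) * ((k : ℝ)⁻¹ ^ t * (2 / k)) := by
        gcongr
        exact htail.trans (by gcongr)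
    _ = 2 * k := by
        rw [pow_add, inv_pow]
        field_simp

/-- Asymptotics of the cosine sums `∑_{j=1}^{k−1} cos(mθ_j)/(1−cos θ_j)^((n−2)/2)`,
`θ_j = 2πj/k`, in terms of `P_{n−2}(2πm/k) = ∑_{i≥1} cos(2πmi/k)/i^(n−2)`. -/
theorem statement15 (n : ℕ) (hn : 4 ≤ n) :
    ∃ C : ℝ, 0 < C ∧ ∃ k₀ : ℕ, ∀ k : ℕ, k₀ ≤ k → ∀ m : ℤ,
      |(∑ j ∈ Finset.Icc 1 (k - 1),
          Real.cos (2 * π * (m : ℝ) * (j : ℝ) / (k : ℝ)) /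
            (1 - Real.cos (2 * π * (j : ℝ) / (k : ℝ))) ^ (((n : ℝ) - 2) / 2)) -
        2 * ((k : ℝ) / (Real.sqrt 2 * π)) ^ (n - 2) *
          ∑' i : ℕ, Real.cos (2 * π * (m : ℝ) * ((i : ℝ) + 1) / (k : ℝ)) /
            ((i : ℝ) + 1) ^ (n - 2)| ≤ C * (k : ℝ) ^ (n - 3) := by
  obtain ⟨t, rfl⟩ := Nat.exists_eq_add_of_le' hn
  set D : ℝ := ((t : ℝ) + 2) / 2 * (π / 2) ^ (t + 2) + 1
  refine ⟨D + 4, by positivity, 1, fun k hk m => ?_⟩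
  have hk' : (1 : ℝ) ≤ k := by exact_mod_cast hk
  have hk0 : (0 : ℝ) < k := by linarith
  rw [show t + 4 - 2 = t + 2 by omega, show t + 4 - 3 = t + 1 by omega,
    show (((t + 4 : ℕ) : ℝ) - 2) / 2 = ((t + 2 : ℕ) : ℝ) / 2 by push_cast; ring]
  set c : ℝ → ℝ := fun x => Real.cos (2 * π * (m : ℝ) * x / (k : ℝ)) with hcdef
  have hc (x : ℝ) : |c x| ≤ 1 := Real.abs_cos_le_one _
  have hcsymm (x : ℝ) : c (k - x) = c x := by
    have : 2 * π * (m : ℝ) * (k - x) / k = m * (2 * π) - 2 * π * m * x / k := by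
      field_simp
    simp only [hcdef]
    rw [this, Real.cos_int_mul_two_pi_sub]
  set S : ℝ := ∑ j ∈ Finset.Icc 1 (k - 1), c j * (j : ℝ)⁻¹ ^ (t + 2) with hS
  set T : ℝ := ∑' i : ℕ, c ((i : ℝ) + 1) * ((i : ℝ) + 1)⁻¹ ^ (t + 2) with hT
  have hTS : (k : ℝ) ^ (t + 2) * |T - S| ≤ 2 * k := by
    have hS' : S = ∑ i ∈ Finset.range (k - 1), c ((i : ℝ) + 1) * ((i : ℝ) + 1)⁻¹ ^ (t + 2) := by
      have := Finset.sum_Ico_add' (fun j : ℕ => c j * (j : ℝ)⁻¹ ^ (t + 2)) 0 (k - 1) 1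
      simp only [Nat.cast_add, Nat.cast_one] at this
      rw [Finset.range_eq_Ico, this]
      rfl
    rw [hS']
    exact pow_mul_abs_tsum_sub_sum_le t hk hc
  have hSrefl : S = ∑ j ∈ Finset.Icc 1 (k - 1), c j * ((k : ℝ) - j)⁻¹ ^ (t + 2) := by
    refine Finset.sum_nbij' (fun j => k - j) (fun j => k - j) ?_ ?_ ?_ ?_ ?_
    · intro j hj; simp only [Finset.mem_Icc] at hj ⊢; omega
    · intro j hj; simp only [Finset.mem_Icc] at hj ⊢; omega
    · intro j hj; simp only [Finset.mem_Icc] at hj; omega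
    · intro j hj; simp only [Finset.mem_Icc] at hj; omega
    · intro j hj
      simp only [Finset.mem_Icc] at hj
      rw [Nat.cast_sub (by omega), hcsymm, sub_sub_cancel]
  set A : ℝ := (Real.sqrt 2)⁻¹ ^ (t + 2) with hA
  have hA0 : 0 ≤ A := by positivity
  have hA1 : A ≤ 1 := pow_le_one₀ (by positivity)
    (inv_le_one_of_one_le₀ (Real.one_le_sqrt.2 one_le_two))
  set B : ℝ := (k / π) ^ (t + 2) with hB
  set h : ℕ → ℝ := fun j => (Real.sin (π * j / k))⁻¹ ^ (t + 2) - (π * j / k)⁻¹ ^ (t + 2) -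
    (π - π * j / k)⁻¹ ^ (t + 2) with hh
  have hbound (j : ℕ) (hj : j ∈ Finset.Icc 1 (k - 1)) : |c j * h j| ≤ D * (k : ℝ) ^ t := by
    rw [Finset.mem_Icc] at hj
    have hj1 : (1 : ℝ) ≤ j := by exact_mod_cast hj.1
    have hjk : (j : ℝ) + 1 ≤ k := by exact_mod_cast (by omega : j + 1 ≤ k)
    have hpi := Real.pi_gt_three
    have hx : (k : ℝ)⁻¹ ≤ π * j / k := by
      rw [inv_eq_one_div]
      gcongr
      nlinarith
    have hx' : (k : ℝ)⁻¹ ≤ π - π * j / k := by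
      rw [show π - π * j / k = π * (k - j) / k by field_simp, inv_eq_one_div]
      gcongr
      nlinarith
    have hkinv : 0 < (k : ℝ)⁻¹ := by positivity
    rw [abs_mul]
    refine (mul_le_of_le_one_left (abs_nonneg _) (hc _)).trans ?_
    exact abs_inv_sin_pow_sub_le t (by linarith) (by linarith) hk'
      (inv_le_of_inv_le₀ hk0 hx) (inv_le_of_inv_le₀ hk0 hx')
  have hsumh : |∑ j ∈ Finset.Icc 1 (k - 1), c j * h j| ≤ D * (k : ℝ) ^ (t + 1) := by
    refine (Finset.abs_sum_le_sum_abs _ _).trans ((Finset.sum_le_sum hbound).trans ?_)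
    rw [Finset.sum_const, Nat.card_Icc, Nat.add_sub_cancel, nsmul_eq_mul, pow_succ]
    have : ((k - 1 : ℕ) : ℝ) ≤ k := by exact_mod_cast Nat.sub_le k 1
    calc ((k - 1 : ℕ) : ℝ) * (D * (k : ℝ) ^ t) ≤ k * (D * (k : ℝ) ^ t) := by gcongr
      _ = D * ((k : ℝ) ^ t * k) := by ring
  have hmain : ∑ j ∈ Finset.Icc 1 (k - 1), c j /
      (1 - Real.cos (2 * π * (j : ℝ) / (k : ℝ))) ^ (((t + 2 : ℕ) : ℝ) / 2) =
      A * (∑ j ∈ Finset.Icc 1 (k - 1), c j * h j) + 2 * (A * B) * S := by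
    have : 2 * (A * B) * S = A * (B * S + B * S) := by ring
    rw [this]
    nth_rewrite 2 [hSrefl]
    rw [hS, ← mul_add, Finset.mul_sum, Finset.mul_sum, ← Finset.sum_add_distrib,
      ← Finset.sum_add_distrib, Finset.mul_sum]
    refine Finset.sum_congr rfl fun j hj => ?_
    rw [Finset.mem_Icc] at hj
    have hj0 : (0 : ℝ) < j := by exact_mod_cast hj.1
    have hjk : (j : ℝ) < k := by exact_mod_cast (by omega : j < k)
    have hsin : 0 < Real.sin (π * j / k) := by
      apply Real.sin_pos_of_pos_of_lt_pi (by positivity)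
      rw [div_lt_iff₀ hk0]
      gcongr
    rw [show 2 * π * (j : ℝ) / k = 2 * (π * j / k) by ring,
      one_sub_cos_two_mul_rpow_half hsin, div_eq_mul_inv, ← inv_pow, mul_inv, mul_pow]
    have e1 : (π * j / k)⁻¹ ^ (t + 2) = B * (j : ℝ)⁻¹ ^ (t + 2) := by
      rw [hB, ← mul_pow]
      congr 1
      field_simp
    have e2 : (π - π * j / k)⁻¹ ^ (t + 2) = B * ((k : ℝ) - j)⁻¹ ^ (t + 2) := by
      rw [hB, ← mul_pow, show π - π * j / k = π * (k - j) / k by field_simp, inv_div]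
      congr 1
      rw [div_mul_eq_div_div, div_eq_mul_inv _ ((k : ℝ) - j)]
    simp only [hh]
    rw [e1, e2]
    ring
  have hTeq : ∑' i : ℕ, c ((i : ℝ) + 1) / ((i : ℝ) + 1) ^ (t + 2) = T := by
    simp_rw [hT, inv_pow, div_eq_mul_inv]
  have hAB : ((k : ℝ) / (Real.sqrt 2 * π)) ^ (t + 2) = A * B := by
    rw [hA, hB, ← mul_pow]
    congr 1
    field_simp
  change |(∑ j ∈ Finset.Icc 1 (k - 1), c j /
      (1 - Real.cos (2 * π * (j : ℝ) / (k : ℝ))) ^ (((t + 2 : ℕ) : ℝ) / 2)) -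
    2 * ((k : ℝ) / (Real.sqrt 2 * π)) ^ (t + 2) *
      ∑' i : ℕ, c ((i : ℝ) + 1) / ((i : ℝ) + 1) ^ (t + 2)| ≤ _
  rw [hmain, hTeq, hAB]
  have hBk : B ≤ (k : ℝ) ^ (t + 2) := by
    rw [hB]
    gcongr
    exact div_le_self hk0.le (by linarith [Real.pi_gt_three])
  have hB0 : 0 ≤ B := by positivity
  calc |A * (∑ j ∈ Finset.Icc 1 (k - 1), c j * h j) + 2 * (A * B) * S - 2 * (A * B) * T|
      = |A * ((∑ j ∈ Finset.Icc 1 (k - 1), c j * h j) - 2 * (B * (T - S)))| := by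
        congr 1
        ring
    _ ≤ |(∑ j ∈ Finset.Icc 1 (k - 1), c j * h j) - 2 * (B * (T - S))| := by
        rw [abs_mul, abs_of_nonneg hA0]
        exact mul_le_of_le_one_left (abs_nonneg _) hA1
    _ ≤ |∑ j ∈ Finset.Icc 1 (k - 1), c j * h j| + |2 * (B * (T - S))| := abs_sub _ _
    _ ≤ D * (k : ℝ) ^ (t + 1) + 2 * (2 * k) := by
        rw [abs_mul, abs_mul, abs_of_nonneg hB0, abs_two]
        have := (mul_le_mul_of_nonneg_right hBk (abs_nonneg _)).trans hTS
        linarith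
    _ ≤ D * (k : ℝ) ^ (t + 1) + 4 * (k : ℝ) ^ (t + 1) := by
        have : (k : ℝ) ≤ k ^ (t + 1) := le_self_pow₀ hk' t.succ_ne_zero
        linarith
    _ = (D + 4) * (k : ℝ) ^ (t + 1) := by ring
end

section
/- Let n ≥ 4 be an integer. There exist a constant C > 0 and an integer k₀ such that for every integer k ≥ k₀ and every integer m, | ∑_{j=1}^{k−1} sin(2πj/k)·sin(2πmj/k)/(1−cos(2πj/k))^(n/2) − 2√2·(k/(√2·π))^(n−1) · ∑_{i=1}^∞ sin(2πmi/k)/i^(n−1) | ≤ C·k^(n−2). -/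
open scoped BigOperators
open Real

/-- Comparison of `cos x / sin x ^ p` with `1 / x ^ p` on the left half of `(0, π)`. -/
lemma abs_cos_div_sin_pow_sub_inv_pow_le (p : ℕ) {x : ℝ} (hx : 0 < x) (hx' : x ≤ π / 2) :
    |Real.cos x / Real.sin x ^ (p + 1) - 1 / x ^ (p + 1)| ≤
      (p + 2) * (π / 2) ^ (p + 1) * (1 / x ^ p) := by
  have hc0 : 0 ≤ Real.cos x := Real.cos_nonneg_of_mem_Icc ⟨by linarith, hx'⟩
  have hc1 : Real.cos x ≤ 1 := Real.cos_le_one x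
  have hs : 2 / π * x ≤ Real.sin x := Real.mul_le_sin hx.le hx'
  have hspos : 0 < Real.sin x := lt_of_lt_of_le (by positivity) hs
  have hsx : Real.sin x ≤ x := Real.sin_le hx.le
  have hcs : x * Real.cos x ≤ Real.sin x := by
    rcases hx'.lt_or_eq with h | h
    · have h1 := Real.le_tan hx.le h
      have hcpos : 0 < Real.cos x := Real.cos_pos_of_mem_Ioo ⟨by linarith, h⟩
      rwa [Real.tan_eq_sin_div_cos, le_div_iff₀ hcpos] at h1
    · rw [h, Real.cos_pi_div_two, Real.sin_pi_div_two]; simp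
  have hcx : 1 - Real.cos x ≤ x := by
    have h1 : Real.cos x + Real.sin x ≥ 1 := by
      nlinarith [Real.sin_sq_add_cos_sq x, mul_nonneg hc0 hspos.le]
    linarith
  have hbern : 1 - (p + 1) * (1 - Real.cos x) ≤ Real.cos x ^ (p + 1) := by
    have h := one_add_mul_le_pow (a := Real.cos x - 1) (by linarith) (p + 1)
    push_cast at h
    calc _ = 1 + ((p : ℝ) + 1) * (Real.cos x - 1) := by ring
      _ ≤ _ := h
      _ = _ := by ring
  have hxp : 0 < x ^ (p + 1) := by positivity
  have hsp : 0 < Real.sin x ^ (p + 1) := by positivity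
  have hlow : x ^ (p + 1) * Real.cos x ^ (p + 1) ≤ Real.sin x ^ (p + 1) := by
    rw [← mul_pow]; gcongr
  have hup : Real.sin x ^ (p + 1) ≤ x ^ (p + 1) := by gcongr
  have hnum : |Real.cos x * x ^ (p + 1) - Real.sin x ^ (p + 1)| ≤ (p + 2) * x ^ (p + 1) * x := by
    have h1 : x ^ (p + 1) - Real.sin x ^ (p + 1) ≤ x ^ (p + 1) * ((p + 1) * x) := by
      have : x ^ (p + 1) * (1 - Real.cos x ^ (p + 1)) ≤ x ^ (p + 1) * ((p + 1) * x) := by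
        gcongr
        have : ((p : ℝ) + 1) * (1 - Real.cos x) ≤ (p + 1) * x := by gcongr
        linarith
      linarith
    have h2 : x ^ (p + 1) * (1 - Real.cos x) ≤ x ^ (p + 1) * x := by gcongr
    have h3 : 0 ≤ x ^ (p + 1) * (1 - Real.cos x) := mul_nonneg hxp.le (by linarith)
    have h4 : 0 ≤ x ^ (p + 1) * x := by positivity
    rw [abs_le]
    constructor <;> nlinarith
  have hden : (2 / π * x) ^ (p + 1) ≤ Real.sin x ^ (p + 1) := by gcongr
  rw [div_sub_div _ _ hsp.ne' hxp.ne', mul_one, abs_div, abs_of_pos (mul_pos hsp hxp)]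
  calc _ ≤ (p + 2) * x ^ (p + 1) * x / ((2 / π * x) ^ (p + 1) * x ^ (p + 1)) := by gcongr
    _ = _ := by
      rw [mul_pow, div_pow, div_pow]
      field_simp
      ring

/-- Comparison of `cos x / sin x ^ p` with its singular parts at both endpoints of `(0, π)`. -/
lemma exists_abs_cos_div_sin_pow_sub_le (p : ℕ) :
    ∃ C : ℝ, 0 < C ∧ ∀ x : ℝ, 0 < x → x < π →
      |Real.cos x / Real.sin x ^ (p + 1) - (1 / x ^ (p + 1) - 1 / (π - x) ^ (p + 1))| ≤
        C * (1 / x ^ p + 1 / (π - x) ^ p) := by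
  set C₀ : ℝ := (p + 2) * (π / 2) ^ (p + 1) with hC₀
  have half : ∀ x : ℝ, 0 < x → x ≤ π / 2 →
      |Real.cos x / Real.sin x ^ (p + 1) - (1 / x ^ (p + 1) - 1 / (π - x) ^ (p + 1))| ≤
        (C₀ + 1) * (1 / x ^ p + 1 / (π - x) ^ p) := by
    intro x hx hx'
    have h1 := abs_cos_div_sin_pow_sub_inv_pow_le p hx hx'
    rw [← hC₀] at h1
    have hπ := Real.pi_gt_three
    have hy : 1 ≤ π - x := by linarith
    have hy0 : 0 < π - x := by linarith
    have h2 : 1 / (π - x) ^ (p + 1) ≤ 1 / (π - x) ^ p :=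
      one_div_le_one_div_of_le (by positivity) (pow_le_pow_right₀ hy (Nat.le_succ p))
    have h3 : 0 < 1 / (π - x) ^ (p + 1) := by positivity
    have h4 : 0 < 1 / x ^ p := by positivity
    have h5 : 0 ≤ C₀ * (1 / (π - x) ^ p) := by positivity
    rw [abs_le] at h1 ⊢
    constructor <;> nlinarith
  refine ⟨C₀ + 1, by positivity, fun x hx hx' => ?_⟩
  rcases le_total x (π / 2) with h | h
  · exact half x hx h
  · have := half (π - x) (by linarith) (by linarith)
    rw [Real.cos_pi_sub, Real.sin_pi_sub, sub_sub_cancel, add_comm (1 / (π - x) ^ p),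
      ← abs_neg] at this
    convert this using 2
    ring

lemma inv_pow_mul_div_le (p : ℕ) (hp : 2 ≤ p) {a k : ℝ} (ha : 1 ≤ a) (hk : 0 < k) :
    1 / (π * a / k) ^ p ≤ k ^ p * (1 / a ^ 2) := by
  have h1 : a ^ 2 ≤ a ^ p := pow_le_pow_right₀ ha hp
  have h2 : (1 : ℝ) ≤ π ^ p := one_le_pow₀ (by linarith [Real.pi_gt_three])
  have h3 : a ^ 2 ≤ (π * a) ^ p := by
    rw [mul_pow]
    nlinarith [sq_nonneg a]
  rw [div_pow, one_div_div, mul_one_div]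
  gcongr

lemma summable_one_div_succ_sq : Summable fun i : ℕ => 1 / ((i : ℝ) + 1) ^ 2 := by
  have h := (summable_nat_add_iff 1).2 (Real.summable_one_div_nat_pow.2 one_lt_two)
  simpa using h

/-- The sum of `cos x / sin x ^ (p + 1)`, weighted by `sin (2mx)`, over
`x_j = πj/k`, agrees with twice the series of its singular part up to `O(k ^ p)`. -/
lemma exists_abs_sum_cos_div_sin_pow_sub_tsum_le (p : ℕ) (hp : 2 ≤ p) :
    ∃ C : ℝ, 0 < C ∧ ∀ (K : ℕ) (m : ℤ),
      |∑ i ∈ Finset.range K, Real.cos (π * (i + 1) / (K + 1)) /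
            Real.sin (π * (i + 1) / (K + 1)) ^ (p + 1) *
            Real.sin (2 * m * (π * (i + 1) / (K + 1))) -
        2 * ∑' i : ℕ, Real.sin (2 * m * (π * (i + 1) / (K + 1))) /
            (π * (i + 1) / (K + 1)) ^ (p + 1)| ≤ C * ((K : ℝ) + 1) ^ p := by
  obtain ⟨C, hC, hbound⟩ := exists_abs_cos_div_sin_pow_sub_le p
  set Z : ℝ := ∑' i : ℕ, 1 / ((i : ℝ) + 1) ^ 2 with hZ
  have hsum := summable_one_div_succ_sq
  have hZpos : 0 < Z := hsum.tsum_pos (fun i => by positivity) 0 (by positivity)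
  refine ⟨(2 * C + 2) * Z, by positivity, fun K m => ?_⟩
  have hk : (0 : ℝ) < (K : ℝ) + 1 := by positivity
  set x : ℕ → ℝ := fun i => π * (i + 1) / (K + 1) with hx
  set s : ℕ → ℝ := fun i => Real.sin (2 * m * x i) with hs
  have hxpos : ∀ i, 0 < x i := fun i => by positivity
  have hxinv : ∀ i, 1 / x i ^ p ≤ ((K : ℝ) + 1) ^ p * (1 / ((i : ℝ) + 1) ^ 2) := fun i =>
    inv_pow_mul_div_le p hp (by linarith [(Nat.cast_nonneg i : (0 : ℝ) ≤ i)]) hk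
  have hs1 : ∀ i, |s i| ≤ 1 := fun i => Real.abs_sin_le_one _
  have hrefl : ∀ i ∈ Finset.range K, x (K - 1 - i) = π - x i := by
    intro i hi
    have hi' := Finset.mem_range.1 hi
    have : ((K - 1 - i : ℕ) : ℝ) = K - 1 - i := by
      rw [Nat.sub_sub, Nat.cast_sub (by omega)]; push_cast; ring
    simp only [hx, this]
    field_simp
    ring
  have hsrefl : ∀ i ∈ Finset.range K, s (K - 1 - i) = -s i := by
    intro i hi
    simp only [hs, hrefl i hi]
    rw [show 2 * (m : ℝ) * (π - x i) = (m : ℝ) * (2 * π) - 2 * m * x i by ring,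
      Real.sin_int_mul_two_pi_sub]
  have hxlt : ∀ i ∈ Finset.range K, x i < π := by
    intro i hi
    have h := hxpos (K - 1 - i)
    rw [hrefl i hi] at h
    linarith
  have hB : ∑ i ∈ Finset.range K, s i / x i ^ (p + 1) =
      ∑ i ∈ Finset.range K, -s i / (π - x i) ^ (p + 1) := by
    rw [← Finset.sum_range_reflect]
    exact Finset.sum_congr rfl fun i hi => by rw [hrefl i hi, hsrefl i hi]
  have hR : ∑ i ∈ Finset.range K, 1 / (π - x i) ^ p = ∑ i ∈ Finset.range K, 1 / x i ^ p := by
    rw [← Finset.sum_range_reflect (fun i => 1 / x i ^ p)]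
    exact Finset.sum_congr rfl fun i hi => by rw [hrefl i hi]
  have hfin : ∑ i ∈ Finset.range K, 1 / x i ^ p ≤ ((K : ℝ) + 1) ^ p * Z := by
    calc _ ≤ ∑ i ∈ Finset.range K, ((K : ℝ) + 1) ^ p * (1 / ((i : ℝ) + 1) ^ 2) :=
          Finset.sum_le_sum fun i _ => hxinv i
      _ ≤ _ := by
          rw [← Finset.mul_sum]
          gcongr
          exact hsum.sum_le_tsum _ fun i _ => by positivity
  have hhead : |∑ i ∈ Finset.range K, Real.cos (x i) / Real.sin (x i) ^ (p + 1) * s i -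
      2 * ∑ i ∈ Finset.range K, s i / x i ^ (p + 1)| ≤ 2 * C * (((K : ℝ) + 1) ^ p * Z) := by
    have hsplit : ∑ i ∈ Finset.range K, Real.cos (x i) / Real.sin (x i) ^ (p + 1) * s i -
        2 * ∑ i ∈ Finset.range K, s i / x i ^ (p + 1) =
        ∑ i ∈ Finset.range K, (Real.cos (x i) / Real.sin (x i) ^ (p + 1) -
          (1 / x i ^ (p + 1) - 1 / (π - x i) ^ (p + 1))) * s i := by
      rw [two_mul]
      nth_rewrite 2 [hB]
      rw [← Finset.sum_add_distrib, ← Finset.sum_sub_distrib]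
      exact Finset.sum_congr rfl fun i _ => by ring
    rw [hsplit]
    calc _ ≤ ∑ i ∈ Finset.range K, C * (1 / x i ^ p + 1 / (π - x i) ^ p) := by
          refine (Finset.abs_sum_le_sum_abs _ _).trans (Finset.sum_le_sum fun i hi => ?_)
          rw [abs_mul]
          exact (mul_le_of_le_one_right (abs_nonneg _) (hs1 i)).trans
            (hbound _ (hxpos i) (hxlt i hi))
      _ = 2 * C * ∑ i ∈ Finset.range K, 1 / x i ^ p := by
          rw [← Finset.mul_sum, Finset.sum_add_distrib, hR]; ring
      _ ≤ _ := by gcongr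
  have htailterm : ∀ i : ℕ, ‖s (i + K) / x (i + K) ^ (p + 1)‖ ≤
      ((K : ℝ) + 1) ^ p * (1 / ((i : ℝ) + 1) ^ 2) := by
    intro i
    have hxge : 1 ≤ x (i + K) := by
      have : π * 1 ≤ π * ((i + K : ℕ) + 1) / (K + 1) := by
        rw [mul_div_assoc]
        gcongr
        rw [one_le_div hk]
        push_cast
        linarith [(Nat.cast_nonneg i : (0 : ℝ) ≤ i)]
      simp only [hx]
      linarith [Real.pi_gt_three]
    have hpos := hxpos (i + K)
    rw [Real.norm_eq_abs, abs_div, abs_of_pos (pow_pos hpos (p + 1))]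
    calc _ ≤ 1 / x (i + K) ^ p := by
          gcongr
          · exact hs1 _
          · exact Nat.le_succ p
      _ ≤ _ := hxinv _
      _ ≤ _ := by
          push_cast
          gcongr
          linarith [(Nat.cast_nonneg K : (0 : ℝ) ≤ K)]
  have htailsum : Summable fun i : ℕ => s (i + K) / x (i + K) ^ (p + 1) :=
    Summable.of_norm_bounded (hsum.mul_left _) htailterm
  have htail : |∑' i : ℕ, s (i + K) / x (i + K) ^ (p + 1)| ≤ ((K : ℝ) + 1) ^ p * Z := by
    rw [← Real.norm_eq_abs]
    exact tsum_of_norm_bounded (hsum.hasSum.mul_left _) htailterm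
  have hT := ((summable_nat_add_iff (f := fun i => s i / x i ^ (p + 1)) K).1
    htailsum).sum_add_tsum_nat_add K
  change |∑ i ∈ Finset.range K, Real.cos (x i) / Real.sin (x i) ^ (p + 1) * s i -
    2 * ∑' i : ℕ, s i / x i ^ (p + 1)| ≤ _
  rw [← hT]
  rw [abs_le] at hhead htail ⊢
  constructor <;> linarith

/-- Half-angle form of the summand. -/
lemma sin_div_one_sub_cos_rpow (p : ℕ) {x : ℝ} (hx : 0 < Real.sin x) :
    Real.sin (2 * x) / (1 - Real.cos (2 * x)) ^ (((p + 2 : ℕ) : ℝ) / 2) =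
      √2 / √2 ^ (p + 1) * (Real.cos x / Real.sin x ^ (p + 1)) := by
  have h1 : 1 - Real.cos (2 * x) = (√2 * Real.sin x) ^ 2 := by
    rw [mul_pow, Real.sq_sqrt (by norm_num), Real.cos_two_mul]
    linarith [Real.sin_sq_add_cos_sq x]
  have h2 : (1 - Real.cos (2 * x)) ^ (((p + 2 : ℕ) : ℝ) / 2) = (√2 * Real.sin x) ^ (p + 2) := by
    rw [h1, ← Real.rpow_natCast _ 2, ← Real.rpow_mul (by positivity), ← Real.rpow_natCast]
    congr 1
    push_cast
    ring
  rw [h2, Real.sin_two_mul, mul_pow]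
  have h3 : (2 : ℝ) = √2 * √2 := (Real.mul_self_sqrt (by norm_num)).symm
  have h4 : √2 ≠ 0 := by positivity
  have h5 : 2 * Real.sin x * Real.cos x = √2 * √2 * Real.sin x * Real.cos x := by rw [← h3]
  rw [h5]
  field_simp
  ring

/-- Asymptotics of the sums `∑_{j=1}^{k−1} sin θ_j sin(mθ_j)/(1−cos θ_j)^(n/2)`,
`θ_j = 2πj/k`, in terms of `Q_{n−1}(2πm/k) = ∑_{i≥1} sin(2πmi/k)/i^(n−1)`. -/
theorem statement16 (n : ℕ) (hn : 4 ≤ n) :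
    ∃ C : ℝ, 0 < C ∧ ∃ k₀ : ℕ, ∀ k : ℕ, k₀ ≤ k → ∀ m : ℤ,
      |(∑ j ∈ Finset.Icc 1 (k - 1),
          Real.sin (2 * π * (j : ℝ) / (k : ℝ)) * Real.sin (2 * π * (m : ℝ) * (j : ℝ) / (k : ℝ)) /
            (1 - Real.cos (2 * π * (j : ℝ) / (k : ℝ))) ^ ((n : ℝ) / 2)) -
        2 * Real.sqrt 2 * ((k : ℝ) / (Real.sqrt 2 * π)) ^ (n - 1) *
          ∑' i : ℕ, Real.sin (2 * π * (m : ℝ) * ((i : ℝ) + 1) / (k : ℝ)) /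
            ((i : ℝ) + 1) ^ (n - 1)| ≤ C * (k : ℝ) ^ (n - 2) := by
  obtain ⟨p, rfl⟩ : ∃ p, n = p + 2 := ⟨n - 2, by omega⟩
  obtain ⟨C, hC, hmain⟩ := exists_abs_sum_cos_div_sin_pow_sub_tsum_le p (by omega)
  set c : ℝ := √2 / √2 ^ (p + 1) with hc
  have hcpos : 0 < c := by positivity
  refine ⟨c * C, by positivity, 1, fun k hk m => ?_⟩
  obtain ⟨K, rfl⟩ : ∃ K, k = K + 1 := ⟨k - 1, by omega⟩
  have hsum : ∑ j ∈ Finset.Icc 1 (K + 1 - 1),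
      Real.sin (2 * π * (j : ℝ) / ((K + 1 : ℕ) : ℝ)) *
        Real.sin (2 * π * (m : ℝ) * (j : ℝ) / ((K + 1 : ℕ) : ℝ)) /
          (1 - Real.cos (2 * π * (j : ℝ) / ((K + 1 : ℕ) : ℝ))) ^ (((p + 2 : ℕ) : ℝ) / 2) =
      c * ∑ i ∈ Finset.range K, Real.cos (π * (i + 1) / (K + 1)) /
            Real.sin (π * (i + 1) / (K + 1)) ^ (p + 1) *
            Real.sin (2 * m * (π * (i + 1) / (K + 1))) := by
    rw [← Finset.Ico_add_one_right_eq_Icc, Finset.sum_Ico_eq_sum_range, Finset.mul_sum]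
    refine Finset.sum_congr (by simp) fun i hi => ?_
    have hi' : (i : ℝ) + 1 < K + 1 := by
      have : i < K := by simpa using hi
      exact_mod_cast Nat.succ_lt_succ this
    have hsin : 0 < Real.sin (π * (i + 1) / (K + 1)) := by
      refine Real.sin_pos_of_pos_of_lt_pi (by positivity) ?_
      rw [div_lt_iff₀ (by positivity)]
      exact mul_lt_mul_of_pos_left hi' Real.pi_pos
    have h := sin_div_one_sub_cos_rpow p hsin
    rw [← hc] at h
    push_cast at h ⊢
    rw [show 2 * π * (1 + (i : ℝ)) / (K + 1) = 2 * (π * (i + 1) / (K + 1)) by ring,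
      show 2 * π * (m : ℝ) * (1 + (i : ℝ)) / (K + 1) = 2 * m * (π * (i + 1) / (K + 1)) by ring,
      mul_div_right_comm, h]
    ring
  have htsum : 2 * √2 * (((K + 1 : ℕ) : ℝ) / (√2 * π)) ^ (p + 2 - 1) *
      ∑' i : ℕ, Real.sin (2 * π * (m : ℝ) * ((i : ℝ) + 1) / ((K + 1 : ℕ) : ℝ)) /
        ((i : ℝ) + 1) ^ (p + 2 - 1) =
      c * (2 * ∑' i : ℕ, Real.sin (2 * m * (π * (i + 1) / (K + 1))) /
            (π * (i + 1) / (K + 1)) ^ (p + 1)) := by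
    rw [← tsum_mul_left, ← tsum_mul_left, ← tsum_mul_left]
    refine tsum_congr fun i => ?_
    rw [show p + 2 - 1 = p + 1 by omega]
    push_cast
    rw [show 2 * π * (m : ℝ) * ((i : ℝ) + 1) / (K + 1) = 2 * m * (π * (i + 1) / (K + 1)) by ring,
      hc, div_pow, div_pow, mul_pow, mul_pow]
    field_simp
  rw [hsum, htsum, ← mul_sub, abs_mul, abs_of_pos hcpos, mul_assoc]
  have h := hmain K m
  rw [show p + 2 - 2 = p by omega]
  push_cast
  gcongr
end

section
/- Let n ≥ 4 be an integer. There exist a constant C > 0 and an integer k₀ such that for every integer k ≥ k₀ and every integer m, | ∑_{j=1}^{k−1} (((n−2)/2)·cos(2πj/k) + n/2)·(1−cos(2πmj/k))/(1−cos(2πj/k))^(n/2) − 2(n−1)·(k/(√2·π))^n · ∑_{i=1}^∞ (1−cos(2πmi/k))/i^n | ≤ C·k^(n−1). -/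
open scoped BigOperators
open Real

theorem sub_sin_le_cube {x : ℝ} (hx : 0 < x) : x - sin x ≤ x ^ 3 := by
  have := sin_gt_sub_cube hx
  have : 0 < x ^ 3 := by positivity
  linarith

theorem inv_sin_le {x : ℝ} (hx : 0 < x) (hx2 : x ≤ π / 2) : (sin x)⁻¹ ≤ 2 * x⁻¹ := by
  have h1 : 2 / π * x ≤ sin x := mul_le_sin hx.le hx2
  have h2 : x / 2 ≤ sin x := by
    refine le_trans ?_ h1
    have : (1 : ℝ) / 2 ≤ 2 / π := by
      rw [div_le_div_iff₀ (by norm_num) pi_pos]; linarith [pi_le_four]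
    nlinarith
  calc (sin x)⁻¹ ≤ (x / 2)⁻¹ := inv_anti₀ (by positivity) h2
    _ = 2 * x⁻¹ := by rw [inv_div]; ring

theorem abs_inv_sin_sub_inv_le {x : ℝ} (hx : 0 < x) (hx2 : x ≤ π / 2) :
    |(sin x)⁻¹ - x⁻¹| ≤ 4 := by
  have hs : 0 < sin x := sin_pos_of_pos_of_lt_pi hx (by linarith [pi_pos])
  have hsx : sin x ≤ x := sin_le hx.le
  rw [abs_of_nonneg (sub_nonneg.2 (inv_anti₀ hs hsx))]
  calc (sin x)⁻¹ - x⁻¹ = (x - sin x) * (sin x)⁻¹ * x⁻¹ := by field_simp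
    _ ≤ x ^ 3 * (2 * x⁻¹) * x⁻¹ := by
        gcongr
        · exact sub_sin_le_cube hx
        · exact inv_sin_le hx hx2
    _ = 2 * x := by field_simp
    _ ≤ 4 := by linarith [pi_le_four]

/-- The function `x ↦ ((n - 1) - (n - 2) sin² x) / sinⁿ x`, which is the summand's weight, up to the
factor `√2 ^ n`, at the angle `2 * x`. -/
noncomputable def sinWeight (n : ℕ) (x : ℝ) : ℝ :=
  ((n - 1) - (n - 2) * sin x ^ 2) / sin x ^ n

theorem sinWeight_pi_sub (n : ℕ) (x : ℝ) : sinWeight n (π - x) = sinWeight n x := by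
  simp [sinWeight, sin_pi_sub]

theorem abs_sinWeight_sub_le {n : ℕ} (hn : 2 ≤ n) {x : ℝ} (hx : 0 < x) (hx2 : x ≤ π / 2) :
    |sinWeight n x - (n - 1) * x⁻¹ ^ n| ≤
      ((n - 1) * (4 * n) + (n - 2)) * 2 ^ (n - 1) * x⁻¹ ^ (n - 1) := by
  obtain ⟨p, rfl⟩ := Nat.exists_eq_add_of_le' hn
  have hs : 0 < sin x := sin_pos_of_pos_of_lt_pi hx (by linarith [pi_pos])
  have hle := inv_sin_le hx hx2
  have hinv : 0 < x⁻¹ := inv_pos.2 hx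
  have hsinv : 0 < (sin x)⁻¹ := inv_pos.2 hs
  have e : sinWeight (p + 2) x - ((p + 2 : ℕ) - 1) * x⁻¹ ^ (p + 2) =
      (p + 1) * ((sin x)⁻¹ ^ (p + 2) - x⁻¹ ^ (p + 2)) - p * (sin x)⁻¹ ^ p := by
    have h : sinWeight (p + 2) x = (p + 1) * (sin x)⁻¹ ^ (p + 2) - p * (sin x)⁻¹ ^ p := by
      simp only [sinWeight, inv_pow]
      push_cast
      field_simp
      ring
    rw [h]
    push_cast
    ring
  have h1 : |(sin x)⁻¹ ^ (p + 2) - x⁻¹ ^ (p + 2)| ≤ 4 * (p + 2) * (2 * x⁻¹) ^ (p + 1) := by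
    refine (abs_pow_sub_pow_le _ _ _).trans ?_
    rw [abs_of_pos hsinv, abs_of_pos hinv]
    push_cast
    have : max (sin x)⁻¹ x⁻¹ ≤ 2 * x⁻¹ := max_le hle (by linarith)
    have h4 := abs_inv_sin_sub_inv_le hx hx2
    gcongr
  have h2 : (sin x)⁻¹ ^ p ≤ (2 * x⁻¹) ^ (p + 1) := by
    have h1le : 1 ≤ 2 * x⁻¹ := by
      rw [← div_eq_mul_inv, le_div_iff₀ hx]; linarith [pi_le_four]
    calc (sin x)⁻¹ ^ p ≤ (2 * x⁻¹) ^ p := by gcongr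
      _ ≤ (2 * x⁻¹) ^ (p + 1) := pow_le_pow_right₀ h1le (by omega)
  rw [e]
  calc |((p : ℝ) + 1) * ((sin x)⁻¹ ^ (p + 2) - x⁻¹ ^ (p + 2)) - p * (sin x)⁻¹ ^ p|
      ≤ |((p : ℝ) + 1) * ((sin x)⁻¹ ^ (p + 2) - x⁻¹ ^ (p + 2))| + |p * (sin x)⁻¹ ^ p| :=
        abs_sub _ _
    _ = ((p : ℝ) + 1) * |(sin x)⁻¹ ^ (p + 2) - x⁻¹ ^ (p + 2)| + p * (sin x)⁻¹ ^ p := by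
        rw [abs_mul, abs_of_nonneg (by positivity : (0 : ℝ) ≤ p + 1),
          abs_of_nonneg (by positivity : (0 : ℝ) ≤ p * (sin x)⁻¹ ^ p)]
    _ ≤ ((p : ℝ) + 1) * (4 * (p + 2) * (2 * x⁻¹) ^ (p + 1)) + p * (2 * x⁻¹) ^ (p + 1) := by
        gcongr
    _ = _ := by
        rw [mul_pow, show p + 2 - 1 = p + 1 by omega]
        push_cast
        ring

theorem exists_abs_sinWeight_sub_le {n : ℕ} (hn : 2 ≤ n) :
    ∃ C : ℝ, 0 < C ∧ ∀ x : ℝ, 0 < x → x < π →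
      |sinWeight n x - (n - 1) * (x⁻¹ ^ n + (π - x)⁻¹ ^ n)| ≤
        C * (x⁻¹ ^ (n - 1) + (π - x)⁻¹ ^ (n - 1)) := by
  have hn' : (2 : ℝ) ≤ n := by exact_mod_cast hn
  set D : ℝ := ((n - 1) * (4 * n) + (n - 2)) * 2 ^ (n - 1)
  have hD0 : 0 ≤ D := by
    have : (0 : ℝ) ≤ n - 1 := by linarith
    have : (0 : ℝ) ≤ n - 2 := by linarith
    positivity
  have half : ∀ x : ℝ, 0 < x → x ≤ π / 2 →
      |sinWeight n x - (n - 1) * (x⁻¹ ^ n + (π - x)⁻¹ ^ n)| ≤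
        (D + n) * (x⁻¹ ^ (n - 1) + (π - x)⁻¹ ^ (n - 1)) := by
    intro x hx hx2
    have hy : 1 ≤ π - x := by linarith [pi_gt_three]
    have hy0 : 0 < (π - x)⁻¹ := inv_pos.2 (by linarith)
    have hx0 : 0 < x⁻¹ := inv_pos.2 hx
    have h1 := abs_sinWeight_sub_le hn hx hx2
    have h2 : (π - x)⁻¹ ^ n ≤ (π - x)⁻¹ ^ (n - 1) :=
      pow_le_pow_of_le_one hy0.le (inv_le_one_of_one_le₀ hy) (by omega)
    have h3 : (n - 1 : ℝ) * (π - x)⁻¹ ^ n ≤ n * (π - x)⁻¹ ^ (n - 1) := by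
      gcongr
      linarith
    have h4 : 0 ≤ (n - 1 : ℝ) * (π - x)⁻¹ ^ n := mul_nonneg (by linarith) (by positivity)
    have h5 : 0 ≤ D * (π - x)⁻¹ ^ (n - 1) := by positivity
    have h6 : 0 ≤ n * x⁻¹ ^ (n - 1) := by positivity
    rw [abs_le] at h1 ⊢
    constructor <;> nlinarith [h1.1, h1.2]
  refine ⟨D + n, by linarith, fun x hx hxπ => ?_⟩
  rcases le_total x (π / 2) with h | h
  · exact half x hx h
  · have := half (π - x) (by linarith) (by linarith)
    rwa [sinWeight_pi_sub, sub_sub_cancel, add_comm ((π - x)⁻¹ ^ n),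
      add_comm ((π - x)⁻¹ ^ (n - 1))] at this

theorem summand_weight_eq (n : ℕ) {x : ℝ} (hx : 0 < x) (hxπ : x < π) :
    (((n : ℝ) - 2) / 2 * cos (2 * x) + n / 2) / (1 - cos (2 * x)) ^ ((n : ℝ) / 2) =
      (√2 ^ n)⁻¹ * sinWeight n x := by
  have hs : 0 < sin x := sin_pos_of_pos_of_lt_pi hx hxπ
  have hc : cos (2 * x) = 1 - 2 * sin x ^ 2 := by rw [cos_two_mul, cos_sq']; ring
  have hp : (1 - cos (2 * x)) ^ ((n : ℝ) / 2) = √2 ^ n * sin x ^ n := by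
    have h : 1 - cos (2 * x) = (√2 * sin x) ^ (2 : ℝ) := by
      rw [hc, rpow_two, mul_pow, sq_sqrt (by norm_num)]; ring
    rw [h, ← rpow_mul (by positivity), mul_div_cancel₀ _ (two_ne_zero), rpow_natCast, mul_pow]
  rw [hp, hc, sinWeight]
  field_simp
  ring

theorem sum_Icc_reflect (f : ℕ → ℝ) (k : ℕ) :
    ∑ j ∈ Finset.Icc 1 (k - 1), f (k - j) = ∑ j ∈ Finset.Icc 1 (k - 1), f j := by
  refine Finset.sum_nbij' (fun j => k - j) (fun j => k - j) ?_ ?_ ?_ ?_ (fun _ _ => rfl) <;>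
    simp only [Finset.mem_Icc] <;> omega

theorem sum_Icc_one_eq_sum_range (f : ℕ → ℝ) (N : ℕ) :
    ∑ j ∈ Finset.Icc 1 N, f j = ∑ i ∈ Finset.range N, f (i + 1) := by
  rw [Finset.range_eq_Ico, Finset.sum_Ico_add' f 0 N 1]
  rfl

theorem summable_inv_succ_pow {n : ℕ} (hn : 2 ≤ n) :
    Summable fun i : ℕ => ((i : ℝ) + 1)⁻¹ ^ n := by
  have := (summable_nat_add_iff 1).2 (Real.summable_nat_pow_inv.2 (by omega : 1 < n))
  simpa using this

theorem summable_weighted_inv_succ_pow {n : ℕ} (hn : 2 ≤ n) {c : ℕ → ℝ}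
    (h0 : ∀ i, 0 ≤ c i) (h2 : ∀ i, c i ≤ 2) :
    Summable fun i : ℕ => c (i + 1) * ((i : ℝ) + 1)⁻¹ ^ n :=
  Summable.of_nonneg_of_le (fun i => mul_nonneg (h0 _) (by positivity))
    (fun i => mul_le_mul_of_nonneg_right (h2 _) (by positivity))
    ((summable_inv_succ_pow hn).mul_left 2)

theorem sum_inv_pow_le_tsum {n : ℕ} (hn : 2 ≤ n) (N : ℕ) :
    ∑ j ∈ Finset.Icc 1 N, (j : ℝ)⁻¹ ^ n ≤ ∑' i : ℕ, ((i : ℝ) + 1)⁻¹ ^ n := by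
  rw [sum_Icc_one_eq_sum_range]
  push_cast
  exact (summable_inv_succ_pow hn).sum_le_tsum _ fun i _ => by positivity

/-- Truncating a series `∑ cᵢ / iⁿ` with `0 ≤ cᵢ ≤ 2` before `i = k` costs at most `O(1 / k)`. -/
theorem abs_sum_sub_tsum_le {n : ℕ} (hn : 3 ≤ n) {c : ℕ → ℝ} (h0 : ∀ i, 0 ≤ c i)
    (h2 : ∀ i, c i ≤ 2) {k : ℕ} (hk : 1 ≤ k) :
    |∑ j ∈ Finset.Icc 1 (k - 1), c j * (j : ℝ)⁻¹ ^ n - ∑' i : ℕ, c (i + 1) * ((i : ℝ) + 1)⁻¹ ^ n|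
      ≤ 2 * (k : ℝ)⁻¹ * ∑' i : ℕ, ((i : ℝ) + 1)⁻¹ ^ (n - 1) := by
  obtain ⟨N, rfl⟩ := Nat.exists_eq_add_of_le' hk
  obtain ⟨p, rfl⟩ := Nat.exists_eq_add_of_le' hn
  have hs := summable_weighted_inv_succ_pow (by omega : 2 ≤ p + 3) h0 h2
  have hz := summable_inv_succ_pow (by omega : 2 ≤ p + 2)
  have hsplit := hs.sum_add_tsum_nat_add N
  have hzsplit := hz.sum_add_tsum_nat_add N
  have hsN := (summable_nat_add_iff N).2 hs
  have hzN := (summable_nat_add_iff N).2 hz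
  have hz0 : 0 ≤ ∑ i ∈ Finset.range N, ((i : ℝ) + 1)⁻¹ ^ (p + 2) :=
    Finset.sum_nonneg fun i _ => by positivity
  have htail : ∑' i : ℕ, c (i + N + 1) * (((i + N : ℕ) : ℝ) + 1)⁻¹ ^ (p + 3) ≤
      2 * ((N + 1 : ℕ) : ℝ)⁻¹ * ∑' i : ℕ, (((i + N : ℕ) : ℝ) + 1)⁻¹ ^ (p + 2) := by
    rw [← tsum_mul_left]
    refine hsN.tsum_le_tsum (fun i => ?_) (hzN.mul_left _)
    rw [pow_succ', ← mul_assoc]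
    gcongr
    · exact h2 _
    · push_cast
      linarith [(Nat.cast_nonneg i : (0 : ℝ) ≤ i)]
  have htail0 : 0 ≤ ∑' i : ℕ, c (i + N + 1) * (((i + N : ℕ) : ℝ) + 1)⁻¹ ^ (p + 3) :=
    tsum_nonneg fun i => mul_nonneg (h0 _) (by positivity)
  have hkpos : 0 ≤ 2 * ((N + 1 : ℕ) : ℝ)⁻¹ := by positivity
  rw [Nat.add_sub_cancel, sum_Icc_one_eq_sum_range, ← hsplit, abs_sub_comm]
  push_cast at *
  rw [add_sub_cancel_left, abs_of_nonneg htail0]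
  refine htail.trans (mul_le_mul_of_nonneg_left ?_ hkpos)
  linarith

/-- The approximation of a weighted sum of `sinWeight` at the points `π j / k` by the corresponding
Dirichlet-type series. -/
theorem exists_abs_sum_sinWeight_sub_le {n : ℕ} (hn : 3 ≤ n) :
    ∃ C : ℝ, 0 < C ∧ ∀ k : ℕ, 1 ≤ k → ∀ c : ℕ → ℝ, (∀ i, 0 ≤ c i) → (∀ i, c i ≤ 2) →
      (∀ i ≤ k, c (k - i) = c i) →
      |∑ j ∈ Finset.Icc 1 (k - 1), c j * sinWeight n (π * j / k) -
        2 * (n - 1) * ((k : ℝ) / π) ^ n * ∑' i : ℕ, c (i + 1) * ((i : ℝ) + 1)⁻¹ ^ n| ≤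
          C * (k : ℝ) ^ (n - 1) := by
  obtain ⟨D, hD, hbound⟩ := exists_abs_sinWeight_sub_le (by omega : 2 ≤ n)
  set Z := ∑' i : ℕ, ((i : ℝ) + 1)⁻¹ ^ (n - 1)
  have hZ0 : 0 ≤ Z := tsum_nonneg fun i => by positivity
  have hn1 : (0 : ℝ) ≤ n - 1 := by
    have : (3 : ℝ) ≤ n := by exact_mod_cast hn
    linarith
  refine ⟨4 * D * Z + 4 * (n - 1) * Z + 1, by positivity, fun k hk c h0 h2 hsymm => ?_⟩
  have hk0 : (0 : ℝ) < k := by exact_mod_cast hk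
  set q : ℝ := (k : ℝ) / π with hq
  have hq0 : 0 < q := by positivity
  have hqk : q ≤ k := div_le_self hk0.le (by linarith [pi_gt_three])
  have hpt : ∀ j ∈ Finset.Icc 1 (k - 1),
      |c j * sinWeight n (π * j / k) -
        (n - 1) * q ^ n * (c j * (j : ℝ)⁻¹ ^ n + c j * ((k - j : ℕ) : ℝ)⁻¹ ^ n)| ≤
        2 * D * q ^ (n - 1) * ((j : ℝ)⁻¹ ^ (n - 1) + ((k - j : ℕ) : ℝ)⁻¹ ^ (n - 1)) := by
    intro j hj
    rw [Finset.mem_Icc] at hj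
    have hj0 : (0 : ℝ) < j := by exact_mod_cast hj.1
    have hjk : (j : ℝ) < k := by exact_mod_cast (by omega : j < k)
    have hcast : ((k - j : ℕ) : ℝ) = k - j := Nat.cast_sub (by omega)
    have hkj : (0 : ℝ) < k - j := by linarith
    have h := hbound (π * j / k) (by positivity)
      (by rw [div_lt_iff₀ hk0]; exact mul_lt_mul_of_pos_left hjk pi_pos)
    have e1 : (π * j / k)⁻¹ = q * (j : ℝ)⁻¹ := by rw [hq]; field_simp
    have e2 : (π - π * j / k)⁻¹ = q * ((k - j : ℕ) : ℝ)⁻¹ := by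
      rw [hcast, show π - π * j / k = (k - j) / q by rw [hq]; field_simp, inv_div, div_eq_mul_inv]
    rw [e1, e2, mul_pow, mul_pow, mul_pow, mul_pow] at h
    calc _ = c j * |sinWeight n (π * j / k) -
          (n - 1) * (q ^ n * (j : ℝ)⁻¹ ^ n + q ^ n * ((k - j : ℕ) : ℝ)⁻¹ ^ n)| := by
          rw [← abs_of_nonneg (h0 j), ← abs_mul, abs_of_nonneg (h0 j)]
          congr 1
          ring
      _ ≤ 2 * (D * (q ^ (n - 1) * (j : ℝ)⁻¹ ^ (n - 1) +
          q ^ (n - 1) * ((k - j : ℕ) : ℝ)⁻¹ ^ (n - 1))) := by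
          gcongr
          exact h2 j
      _ = _ := by ring
  have hrefl : ∑ j ∈ Finset.Icc 1 (k - 1), c j * ((k - j : ℕ) : ℝ)⁻¹ ^ n =
      ∑ j ∈ Finset.Icc 1 (k - 1), c j * (j : ℝ)⁻¹ ^ n := by
    rw [← sum_Icc_reflect (fun j => c j * (j : ℝ)⁻¹ ^ n)]
    refine Finset.sum_congr rfl fun j hj => ?_
    rw [Finset.mem_Icc] at hj
    simp only [hsymm j (by omega)]
  have hmain : |∑ j ∈ Finset.Icc 1 (k - 1), c j * sinWeight n (π * j / k) -
      2 * (n - 1) * q ^ n * ∑ j ∈ Finset.Icc 1 (k - 1), c j * (j : ℝ)⁻¹ ^ n| ≤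
        4 * D * Z * (k : ℝ) ^ (n - 1) := by
    calc _ = |∑ j ∈ Finset.Icc 1 (k - 1), (c j * sinWeight n (π * j / k) -
        (n - 1) * q ^ n * (c j * (j : ℝ)⁻¹ ^ n + c j * ((k - j : ℕ) : ℝ)⁻¹ ^ n))| := by
          rw [Finset.sum_sub_distrib, ← Finset.mul_sum, Finset.sum_add_distrib, hrefl]
          congr 1
          ring
      _ ≤ ∑ j ∈ Finset.Icc 1 (k - 1),
          2 * D * q ^ (n - 1) * ((j : ℝ)⁻¹ ^ (n - 1) + ((k - j : ℕ) : ℝ)⁻¹ ^ (n - 1)) :=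
          (Finset.abs_sum_le_sum_abs _ _).trans (Finset.sum_le_sum hpt)
      _ = 4 * D * (∑ j ∈ Finset.Icc 1 (k - 1), (j : ℝ)⁻¹ ^ (n - 1)) * q ^ (n - 1) := by
          rw [← Finset.mul_sum, Finset.sum_add_distrib,
            sum_Icc_reflect (fun j => (j : ℝ)⁻¹ ^ (n - 1))]
          ring
      _ ≤ 4 * D * Z * (k : ℝ) ^ (n - 1) := by
          have := sum_inv_pow_le_tsum (by omega : 2 ≤ n - 1) (k - 1)
          gcongr
  have htail : |2 * (n - 1) * q ^ n * ∑ j ∈ Finset.Icc 1 (k - 1), c j * (j : ℝ)⁻¹ ^ n -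
      2 * (n - 1) * q ^ n * ∑' i : ℕ, c (i + 1) * ((i : ℝ) + 1)⁻¹ ^ n| ≤
        4 * (n - 1) * Z * (k : ℝ) ^ (n - 1) := by
    rw [← mul_sub, abs_mul, abs_of_nonneg (by positivity : 0 ≤ 2 * ((n : ℝ) - 1) * q ^ n)]
    calc _ ≤ 2 * ((n : ℝ) - 1) * (k : ℝ) ^ n * (2 * (k : ℝ)⁻¹ * Z) := by
          gcongr
          exact abs_sum_sub_tsum_le hn h0 h2 hk
      _ = _ := by
          rw [← Nat.sub_add_cancel (by omega : 1 ≤ n), pow_succ, Nat.add_sub_cancel]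
          field_simp
          ring
  calc _ ≤ 4 * D * Z * (k : ℝ) ^ (n - 1) + 4 * (n - 1) * Z * (k : ℝ) ^ (n - 1) :=
        (abs_sub_le _ _ _).trans (add_le_add hmain htail)
    _ ≤ (4 * D * Z + 4 * (n - 1) * Z + 1) * (k : ℝ) ^ (n - 1) := by
        have : 0 < (k : ℝ) ^ (n - 1) := by positivity
        linarith

/-- Asymptotics of the sums
`∑_{j=1}^{k−1} (((n−2)/2)cos θ_j + n/2)(1−cos(mθ_j))/(1−cos θ_j)^(n/2)`, `θ_j = 2πj/k`,
in terms of `g(2πm/k) = ∑_{i≥1} (1−cos(2πmi/k))/i^n`. -/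
theorem statement17 (n : ℕ) (hn : 4 ≤ n) :
    ∃ C : ℝ, 0 < C ∧ ∃ k₀ : ℕ, ∀ k : ℕ, k₀ ≤ k → ∀ m : ℤ,
      |(∑ j ∈ Finset.Icc 1 (k - 1),
          ((((n : ℝ) - 2) / 2) * Real.cos (2 * π * (j : ℝ) / (k : ℝ)) + (n : ℝ) / 2) *
            (1 - Real.cos (2 * π * (m : ℝ) * (j : ℝ) / (k : ℝ))) /
              (1 - Real.cos (2 * π * (j : ℝ) / (k : ℝ))) ^ ((n : ℝ) / 2)) -
        2 * ((n : ℝ) - 1) * ((k : ℝ) / (Real.sqrt 2 * π)) ^ n *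
          ∑' i : ℕ, (1 - Real.cos (2 * π * (m : ℝ) * ((i : ℝ) + 1) / (k : ℝ))) /
            ((i : ℝ) + 1) ^ n| ≤ C * (k : ℝ) ^ (n - 1) := by
  obtain ⟨C, hC, hbound⟩ := exists_abs_sum_sinWeight_sub_le (by omega : 3 ≤ n)
  refine ⟨C, hC, 1, fun k hk m => ?_⟩
  have hk0 : (0 : ℝ) < k := by exact_mod_cast hk
  set c : ℕ → ℝ := fun j => 1 - cos (2 * π * m * j / k) with hc
  have hsymm : ∀ i ≤ k, c (k - i) = c i := by
    intro i hi
    have e : 2 * π * m * ((k - i : ℕ) : ℝ) / k = m * (2 * π) - 2 * π * m * i / k := by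
      rw [Nat.cast_sub hi]
      field_simp
    simp only [hc, e, cos_int_mul_two_pi_sub]
  have h := hbound k hk c (fun i => sub_nonneg.2 (cos_le_one _))
    (fun i => by linarith [neg_one_le_cos (2 * π * m * i / k)]) hsymm
  have hsum : ∑ j ∈ Finset.Icc 1 (k - 1),
      ((((n : ℝ) - 2) / 2) * cos (2 * π * (j : ℝ) / (k : ℝ)) + (n : ℝ) / 2) *
        (1 - cos (2 * π * (m : ℝ) * (j : ℝ) / (k : ℝ))) /
          (1 - cos (2 * π * (j : ℝ) / (k : ℝ))) ^ ((n : ℝ) / 2) =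
      (√2 ^ n)⁻¹ * ∑ j ∈ Finset.Icc 1 (k - 1), c j * sinWeight n (π * j / k) := by
    rw [Finset.mul_sum]
    refine Finset.sum_congr rfl fun j hj => ?_
    rw [Finset.mem_Icc] at hj
    have hj0 : (0 : ℝ) < j := by exact_mod_cast hj.1
    have hjk : (j : ℝ) < k := by exact_mod_cast (by omega : j < k)
    have hw := summand_weight_eq n (x := π * j / k) (by positivity)
      (by rw [div_lt_iff₀ hk0]; exact mul_lt_mul_of_pos_left hjk pi_pos)
    rw [mul_left_comm, ← hw, show 2 * π * (j : ℝ) / k = 2 * (π * j / k) by ring]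
    ring
  have hseries : ∑' i : ℕ, (1 - cos (2 * π * (m : ℝ) * ((i : ℝ) + 1) / (k : ℝ))) /
      ((i : ℝ) + 1) ^ n = ∑' i : ℕ, c (i + 1) * ((i : ℝ) + 1)⁻¹ ^ n := by
    refine tsum_congr fun i => ?_
    simp only [hc, inv_pow, Nat.cast_add, Nat.cast_one, div_eq_mul_inv]
  have hpow : ((k : ℝ) / (√2 * π)) ^ n = (√2 ^ n)⁻¹ * ((k : ℝ) / π) ^ n := by
    rw [← inv_pow, ← mul_pow]
    congr 1
    field_simp
  have hfac : (√2 ^ n)⁻¹ ≤ 1 :=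
    inv_le_one_of_one_le₀ (one_le_pow₀ (one_le_sqrt.2 (by norm_num)))
  rw [hsum, hseries, hpow]
  refine le_trans (le_of_eq ?_)
    ((mul_le_of_le_one_left (abs_nonneg _) hfac).trans h)
  rw [← abs_of_nonneg (by positivity : 0 ≤ (√2 ^ n)⁻¹), ← abs_mul,
    abs_of_nonneg (by positivity : 0 ≤ (√2 ^ n)⁻¹)]
  congr 1
  ring
end
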